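/- arXiv:1005.4278 — 2 statements merged into one kernel-verified Lean document; each statement's English description precedes it below -/
import Mathlib

section
/- Let G be a finite simple connected graph and w an even primitive walk of G that has a pure cyclic block. Then B_w does not belong to the universal Gröbner basis of I_G; that is, B_w lies in no reduced Gröbner basis of I_G with respect to any term order. -/
open MvPolynomial

noncomputable section

/-! ### Term orders, initial terms, (reduced) Gröbner bases, universal Gröbner basis -/

/-- A term order on the monomials (exponent vectors) in variables indexed by `σ`:
a linear order for which `0` is least and which is compatible with addition. -/
structure TermOrder (σ : Type*) where
  lo : LinearOrder (σ →₀ ℕ)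
  zero_min : ∀ u : σ →₀ ℕ, lo.le 0 u
  add_right : ∀ u v w : σ →₀ ℕ, lo.le u v → lo.le (u + w) (v + w)

variable {σ : Type*} {K : Type*} [Field K]

/-- The leading (largest) exponent of a polynomial with respect to a term order
(junk value `0` if `f = 0`). -/
def TermOrder.leadExp (t : TermOrder σ) (f : MvPolynomial σ K) : σ →₀ ℕ :=
  haveI := Classical.propDecidable (f = 0)
  if h : f = 0 then 0
  else @Finset.max' _ t.lo f.support
    (Finset.nonempty_iff_ne_empty.mpr fun he => h (MvPolynomial.support_eq_empty.mp he))

/-- The initial term of a polynomial with respect to a term order. -/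
def TermOrder.initial (t : TermOrder σ) (f : MvPolynomial σ K) : MvPolynomial σ K :=
  monomial (t.leadExp f) (f.coeff (t.leadExp f))

/-- `𝒢` is a Gröbner basis of `I` w.r.t. the term order `t`. -/
def IsGroebnerBasis (t : TermOrder σ) (I : Ideal (MvPolynomial σ K))
    (𝒢 : Finset (MvPolynomial σ K)) : Prop :=
  (𝒢 : Set (MvPolynomial σ K)) ⊆ (I : Set (MvPolynomial σ K)) ∧
    Ideal.span (t.initial '' (𝒢 : Set (MvPolynomial σ K))) =
      Ideal.span (t.initial '' (I : Set (MvPolynomial σ K)))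

/-- `𝒢` is a reduced Gröbner basis of `I` w.r.t. `t`: a Gröbner basis, all of whose elements
are monic, and no monomial occurring in an element of `𝒢` is divisible by the initial term of
a different element of `𝒢`. -/
def IsReducedGroebnerBasis (t : TermOrder σ) (I : Ideal (MvPolynomial σ K))
    (𝒢 : Finset (MvPolynomial σ K)) : Prop :=
  IsGroebnerBasis t I 𝒢 ∧
    (∀ g ∈ 𝒢, g.coeff (t.leadExp g) = 1) ∧
    (∀ g ∈ 𝒢, ∀ g' ∈ 𝒢, g' ≠ g → ∀ u ∈ g.support, ¬ t.leadExp g' ≤ u)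

/-- The universal Gröbner basis of `I`: the union of all reduced Gröbner bases of `I`
over all term orders. -/
def UniversalGB (I : Ideal (MvPolynomial σ K)) : Set (MvPolynomial σ K) :=
  {f | ∃ (t : TermOrder σ) (𝒢 : Finset (MvPolynomial σ K)),
    IsReducedGroebnerBasis t I 𝒢 ∧ f ∈ 𝒢}

/-! ### Binomials, primitive binomials (Graver basis), circuits -/

/-- The binomial `x^u - x^v`. -/
def binom (K : Type*) [Field K] {σ : Type*} (u v : σ →₀ ℕ) : MvPolynomial σ K :=
  monomial u 1 - monomial v 1

/-- `f` is a primitive binomial of `I`: `f = x^u - x^v ∈ I` and there is no other binomial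
`x^w - x^z ∈ I` with `x^w ∣ x^u` and `x^z ∣ x^v`.  The set of primitive binomials of `I`
is the Graver basis of `I`. -/
def IsPrimitiveBinomial (I : Ideal (MvPolynomial σ K)) (f : MvPolynomial σ K) : Prop :=
  ∃ u v : σ →₀ ℕ, u ≠ v ∧ f = binom K u v ∧ f ∈ I ∧
    ∀ w z : σ →₀ ℕ, w ≠ z → binom K w z ∈ I → w ≤ u → z ≤ v → w = u ∧ z = v

/-- `f` is a circuit of `I`: an irreducible binomial of `I` whose support (set of variables
occurring in it) is minimal among the supports of nonzero binomials of `I`. -/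
def IsCircuitBinomial (I : Ideal (MvPolynomial σ K)) (f : MvPolynomial σ K) : Prop :=
  (∃ u v : σ →₀ ℕ, u ≠ v ∧ f = binom K u v) ∧ f ∈ I ∧ Irreducible f ∧
    ∀ g : MvPolynomial σ K, (∃ u v : σ →₀ ℕ, u ≠ v ∧ g = binom K u v) → g ∈ I →
      g.vars ⊆ f.vars → g.vars = f.vars

/-- The toric ideal of a vector configuration `A = (a_1, …, a_m) ⊆ ℕ^n`: the ideal generated
by all binomials `x^u - x^v` with `Σ uᵢ aᵢ = Σ vᵢ aᵢ`. -/
def toricIdealOfConfig (K : Type*) [Field K] {m n : ℕ} (A : Fin m → Fin n → ℕ) :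
    Ideal (MvPolynomial (Fin m) K) :=
  Ideal.span {f | ∃ u v : Fin m →₀ ℕ,
    f = binom K u v ∧ (∑ i, u i • A i) = ∑ i, v i • A i}

/-! ### Toric ideals of graphs -/

variable {V : Type*}

/-- The image `x_u * x_v` of an edge `e = {u, v}`. -/
def edgeImage (K : Type*) [Field K] {V : Type*} (e : Sym2 V) : MvPolynomial V K :=
  Sym2.lift ⟨fun a b => X a * X b, fun a b => mul_comm _ _⟩ e

/-- The toric ideal `I_G` of a graph `G`: the kernel of the `K`-algebra map
`K[e : e ∈ E(G)] → K[x_v : v ∈ V(G)]`, `e = {u,v} ↦ x_u x_v`. -/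
def graphToricIdeal (K : Type*) [Field K] (G : SimpleGraph V) :
    Ideal (MvPolynomial G.edgeSet K) :=
  RingHom.ker (MvPolynomial.aeval
    (fun e : G.edgeSet => edgeImage K (e : Sym2 V)) :
      MvPolynomial G.edgeSet K →ₐ[K] MvPolynomial V K).toRingHom

/-- An even closed walk `(v_0, v_1, …, v_{2q} = v_0)` in a graph `G`;
edges and vertices may repeat. -/
structure EvenClosedWalk (G : SimpleGraph V) where
  q : ℕ
  verts : ℕ → V
  adj : ∀ i, i < 2 * q → G.Adj (verts i) (verts (i + 1))
  closed : verts (2 * q) = verts 0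

namespace EvenClosedWalk

variable {G : SimpleGraph V}

/-- The `i`-th edge of the walk, as an element of the edge set of `G`. -/
def edge (w : EvenClosedWalk G) (i : ℕ) (h : i < 2 * w.q) : G.edgeSet :=
  ⟨s(w.verts i, w.verts (i + 1)), w.adj i h⟩

/-- The exponent vector `w⁺` of the monomial `E⁺(w)`, the product of the edges of `w`
in odd position (`1`-indexed). -/
def plusExp (w : EvenClosedWalk G) : G.edgeSet →₀ ℕ :=
  ∑ k : Fin w.q, Finsupp.single (w.edge (2 * (k : ℕ)) (by have := k.isLt; omega)) 1

/-- The exponent vector `w⁻` of the monomial `E⁻(w)`, the product of the edges of `w`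
in even position (`1`-indexed). -/
def minusExp (w : EvenClosedWalk G) : G.edgeSet →₀ ℕ :=
  ∑ k : Fin w.q, Finsupp.single (w.edge (2 * (k : ℕ) + 1) (by have := k.isLt; omega)) 1

end EvenClosedWalk

/-- The monomial `E⁺(w)`. -/
def Eplus (K : Type*) [Field K] {G : SimpleGraph V} (w : EvenClosedWalk G) :
    MvPolynomial G.edgeSet K :=
  monomial w.plusExp 1

/-- The monomial `E⁻(w)`. -/
def Eminus (K : Type*) [Field K] {G : SimpleGraph V} (w : EvenClosedWalk G) :
    MvPolynomial G.edgeSet K :=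
  monomial w.minusExp 1

/-- The binomial `B_w = E⁺(w) - E⁻(w)` of an even closed walk. -/
def Bw (K : Type*) [Field K] {G : SimpleGraph V} (w : EvenClosedWalk G) :
    MvPolynomial G.edgeSet K :=
  binom K w.plusExp w.minusExp

namespace EvenClosedWalk

variable {G : SimpleGraph V}

/-- The number of positions of the walk at which the edge `e` appears. -/
def count [DecidableEq V] (w : EvenClosedWalk G) (e : Sym2 V) : ℕ :=
  ((Finset.range (2 * w.q)).filter fun i => e = s(w.verts i, w.verts (i + 1))).card

/-- The subgraph `𝐰` of `G` spanned by the edges of the walk `w`. -/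
def graph (w : EvenClosedWalk G) : SimpleGraph V :=
  SimpleGraph.fromEdgeSet {e | ∃ i, ∃ _ : i < 2 * w.q, e = s(w.verts i, w.verts (i + 1))}

/-- The set `w⁺` of edges of `w` in odd position (`1`-indexed). -/
def plusEdges (w : EvenClosedWalk G) : Set (Sym2 V) :=
  {e | ∃ k, ∃ _ : k < w.q, e = s(w.verts (2 * k), w.verts (2 * k + 1))}

/-- The set `w⁻` of edges of `w` in even position (`1`-indexed). -/
def minusEdges (w : EvenClosedWalk G) : Set (Sym2 V) :=
  {e | ∃ k, ∃ _ : k < w.q, e = s(w.verts (2 * k + 1), w.verts (2 * k + 2))}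

/-- An even closed walk is primitive if it is nontrivial and there is no even closed
subwalk `ξ` of smaller length with `E⁺(ξ) ∣ E⁺(w)` and `E⁻(ξ) ∣ E⁻(w)`. -/
def IsPrimitive (w : EvenClosedWalk G) : Prop :=
  0 < w.q ∧ ∀ ξ : EvenClosedWalk G, 0 < ξ.q → ξ.q < w.q →
    ¬(ξ.plusExp ≤ w.plusExp ∧ ξ.minusExp ≤ w.minusExp)

/-- The walk `w` is a cycle: it visits no vertex twice. -/
def IsCycle (w : EvenClosedWalk G) : Prop :=
  2 ≤ w.q ∧ ∀ i j, i < 2 * w.q → j < 2 * w.q → w.verts i = w.verts j → i = j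

end EvenClosedWalk

/-! ### Cut vertices, cut edges, blocks, sinks -/

/-- `v` is a cut vertex of `H`: removing `v` (and the edges through it) disconnects two
vertices different from `v` that were connected in `H`. -/
def IsCutVertex (H : SimpleGraph V) (v : V) : Prop :=
  ∃ a b, a ≠ v ∧ b ≠ v ∧ H.Reachable a b ∧
    ¬(SimpleGraph.fromEdgeSet {e | e ∈ H.edgeSet ∧ v ∉ e}).Reachable a b

/-- `e` is a cut edge of `H`: removing it disconnects two vertices connected in `H`. -/
def IsCutEdge (H : SimpleGraph V) (e : Sym2 V) : Prop :=
  e ∈ H.edgeSet ∧ ∃ a b, H.Reachable a b ∧ ¬(H.deleteEdges {e}).Reachable a b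

/-- `H` is biconnected: it has an edge, it is connected (on its support),
and it has no cut vertex. -/
def IsBiconnected (H : SimpleGraph V) : Prop :=
  H.edgeSet.Nonempty ∧ (∀ a ∈ H.support, ∀ b ∈ H.support, H.Reachable a b) ∧
    ∀ v, ¬IsCutVertex H v

/-- `B` is a block of `H`: a maximal biconnected subgraph. -/
def IsBlock (H B : SimpleGraph V) : Prop :=
  B ≤ H ∧ IsBiconnected B ∧ ∀ B', B ≤ B' → B' ≤ H → IsBiconnected B' → B' = B

/-- A graph is a cycle (graph): its edge set is the edge set of a cycle of length `≥ 3`. -/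
def IsCycleGraph (B : SimpleGraph V) : Prop :=
  ∃ (n : ℕ) (f : ℕ → V), 3 ≤ n ∧
    (∀ i j, i < n → j < n → f i = f j → i = j) ∧
    B.edgeSet = {e | ∃ i, ∃ _ : i < n, e = s(f i, f ((i + 1) % n))}

/-- `v` is a sink of the block `B` of the walk `w`: a common vertex of two odd
(or two even) edges of the walk belonging to `B`. -/
def IsSinkOf {G : SimpleGraph V} (w : EvenClosedWalk G) (B : SimpleGraph V) (v : V) : Prop :=
  ∃ e₁ e₂ : Sym2 V, e₁ ≠ e₂ ∧ e₁ ∈ B.edgeSet ∧ e₂ ∈ B.edgeSet ∧ v ∈ e₁ ∧ v ∈ e₂ ∧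
    ((e₁ ∈ w.plusEdges ∧ e₂ ∈ w.plusEdges) ∨ (e₁ ∈ w.minusEdges ∧ e₂ ∈ w.minusEdges))

/-- `B` is a pure cyclic block of the walk `w`: a block of `𝐰` which is a cycle all of whose
edges lie in `w⁺`, or all in `w⁻`. -/
def IsPureCyclicBlock {G : SimpleGraph V} (w : EvenClosedWalk G) (B : SimpleGraph V) : Prop :=
  IsBlock w.graph B ∧ IsCycleGraph B ∧
    (B.edgeSet ⊆ w.plusEdges ∨ B.edgeSet ⊆ w.minusEdges)

/-- A primitive walk is mixed if it has no pure cyclic block. -/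
def EvenClosedWalk.IsMixed {G : SimpleGraph V} (w : EvenClosedWalk G) : Prop :=
  ∀ B : SimpleGraph V, ¬IsPureCyclicBlock w B


/-! ### Term orders are compatible with sums -/

namespace TermOrder

variable (t : TermOrder σ)

lemma le_of_dvd {u v : σ →₀ ℕ} (h : u ≤ v) : t.lo.le u v := by
  obtain ⟨w, rfl⟩ := exists_add_of_le h
  simpa [add_comm] using t.add_right 0 w u (t.zero_min w)

lemma lt_of_not_le {u v : σ →₀ ℕ} (h : ¬ t.lo.le u v) : t.lo.lt v u :=
  @lt_of_not_ge _ t.lo _ _ h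

lemma not_lt_of_le {u v : σ →₀ ℕ} (h : t.lo.le u v) : ¬ t.lo.lt v u :=
  @not_lt_of_ge _ t.lo.toPreorder _ _ h

lemma le_of_not_lt {u v : σ →₀ ℕ} (h : ¬ t.lo.lt v u) : t.lo.le u v :=
  @le_of_not_gt _ t.lo _ _ h

lemma add_le_add {a b c d : σ →₀ ℕ} (h : t.lo.le a b) (h' : t.lo.le c d) :
    t.lo.le (a + c) (b + d) := by
  refine t.lo.le_trans _ _ _ (t.add_right a b c h) ?_
  rw [add_comm b c, add_comm b d]
  exact t.add_right c d b h'

lemma sum_le_sum {ι : Type*} (s : Finset ι) {f g : ι → σ →₀ ℕ}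
    (h : ∀ i ∈ s, t.lo.le (f i) (g i)) : t.lo.le (∑ i ∈ s, f i) (∑ i ∈ s, g i) := by
  classical
  induction s using Finset.induction_on with
  | empty => exact t.lo.le_refl _
  | insert a s ha ih =>
    rw [Finset.sum_insert ha, Finset.sum_insert ha]
    exact t.add_le_add (h a (by simp)) (ih fun i hi => h i (by simp [hi]))

lemma add_lt_add_right {u v : σ →₀ ℕ} (w : σ →₀ ℕ) (h : t.lo.lt u v) :
    t.lo.lt (u + w) (v + w) := by
  apply t.lt_of_not_le
  intro h'
  have h1 := t.add_right u v w (@le_of_lt _ t.lo.toPreorder _ _ h)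
  have h2 : u = v := add_right_cancel (t.lo.le_antisymm _ _ h1 h')
  subst h2
  exact @lt_irrefl _ t.lo.toPreorder _ h

lemma le_of_add_le_add_right {u v w : σ →₀ ℕ} (h : t.lo.le (u + w) (v + w)) : t.lo.le u v :=
  t.le_of_not_lt fun h' => t.not_lt_of_le h (t.add_lt_add_right w h')

lemma le_of_add_self_le {u v : σ →₀ ℕ} (h : t.lo.le (u + u) (v + v)) : t.lo.le u v := by
  refine t.le_of_not_lt fun h' => t.not_lt_of_le h ?_
  have h1 := t.add_lt_add_right v h'
  have h2 := t.add_lt_add_right u h'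
  rw [add_comm v u] at h2
  exact @lt_trans _ t.lo.toPreorder _ _ _ h1 h2

lemma leadExp_eq {f : MvPolynomial σ K} {m : σ →₀ ℕ} (hm : m ∈ f.support)
    (h : ∀ a ∈ f.support, t.lo.le a m) : t.leadExp f = m := by
  have hf : f ≠ 0 := by rintro rfl; simp at hm
  rw [leadExp, dif_neg hf]
  apply t.lo.le_antisymm
  · exact @Finset.max'_le _ t.lo _ _ _ h
  · exact @Finset.le_max' _ t.lo _ _ hm

end TermOrder

lemma mem_support_binom_left {u v : σ →₀ ℕ} (h : u ≠ v) : u ∈ (binom K u v).support := by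
  classical
  simp [binom, MvPolynomial.mem_support_iff, coeff_monomial, h.symm]

lemma mem_support_binom_right {u v : σ →₀ ℕ} (h : u ≠ v) : v ∈ (binom K u v).support := by
  classical
  simp [binom, MvPolynomial.mem_support_iff, coeff_monomial, h]

lemma eq_or_eq_of_mem_support_binom {u v a : σ →₀ ℕ} (h : a ∈ (binom K u v).support) :
    a = u ∨ a = v := by
  classical
  by_contra! hc
  simp [binom, MvPolynomial.mem_support_iff, coeff_monomial, hc.1.symm, hc.2.symm] at h

lemma TermOrder.leadExp_binom_left (t : TermOrder σ) {u v : σ →₀ ℕ} (h : t.lo.lt v u) :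
    t.leadExp (binom K u v) = u := by
  refine t.leadExp_eq (mem_support_binom_left (@ne_of_gt _ t.lo.toPreorder _ _ h)) ?_
  intro a ha
  rcases eq_or_eq_of_mem_support_binom ha with rfl | rfl
  · exact t.lo.le_refl _
  · exact @le_of_lt _ t.lo.toPreorder _ _ h

lemma TermOrder.leadExp_binom_right (t : TermOrder σ) {u v : σ →₀ ℕ} (h : t.lo.lt u v) :
    t.leadExp (binom K u v) = v := by
  refine t.leadExp_eq (mem_support_binom_right (@ne_of_lt _ t.lo.toPreorder _ _ h)) ?_
  intro a ha
  rcases eq_or_eq_of_mem_support_binom ha with rfl | rfl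
  · exact @le_of_lt _ t.lo.toPreorder _ _ h
  · exact t.lo.le_refl _

/-- Every leading exponent of a nonzero element of the ideal is divisible by the leading exponent
of an element of a reduced Gröbner basis. -/
lemma IsReducedGroebnerBasis.exists_leadExp_le {t : TermOrder σ} {I : Ideal (MvPolynomial σ K)}
    {𝒢 : Finset (MvPolynomial σ K)} (h : IsReducedGroebnerBasis t I 𝒢) {f : MvPolynomial σ K}
    (hf : f ∈ I) (hlead : t.leadExp f ∈ f.support) : ∃ g ∈ 𝒢, t.leadExp g ≤ t.leadExp f := by
  classical
  have h1 : t.initial f ∈ Ideal.span (t.initial '' (𝒢 : Set (MvPolynomial σ K))) := by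
    rw [h.1.2]
    exact Ideal.subset_span ⟨f, hf, rfl⟩
  have h2 : t.initial '' (𝒢 : Set (MvPolynomial σ K)) =
      (fun s => monomial s (1 : K)) '' (t.leadExp '' (𝒢 : Set (MvPolynomial σ K))) := by
    rw [Set.image_image]
    refine Set.image_congr fun g hg => ?_
    rw [TermOrder.initial, h.2.1 g hg]
  rw [h2, MvPolynomial.mem_ideal_span_monomial_image] at h1
  obtain ⟨s, ⟨g, hg, rfl⟩, hs⟩ := h1 (t.leadExp f) (by
    rw [MvPolynomial.mem_support_iff] at hlead ⊢
    simpa [TermOrder.initial, coeff_monomial] using hlead)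
  exact ⟨g, hg, hs⟩

/-- Membership of a binomial with leading exponent `u` and trailing exponent `v` in a reduced
Gröbner basis, in terms of exponents: no leading exponent of a binomial with exponents related
by `r` divides `v`, and only `u` itself divides `u`. -/
def TermOrder.IsReducedPair (t : TermOrder σ) (r : (σ →₀ ℕ) → (σ →₀ ℕ) → Prop)
    (u v : σ →₀ ℕ) : Prop :=
  t.lo.lt v u ∧ ∀ a b, r a b → t.lo.lt b a → ¬ a ≤ v ∧ (a ≤ u → a = u)

lemma IsReducedGroebnerBasis.isReducedPair {t : TermOrder σ} {I : Ideal (MvPolynomial σ K)}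
    {𝒢 : Finset (MvPolynomial σ K)} (h : IsReducedGroebnerBasis t I 𝒢) {u v : σ →₀ ℕ}
    {g : MvPolynomial σ K} (hg : g ∈ 𝒢) (hu : t.leadExp g = u) (hus : u ∈ g.support)
    (hvs : v ∈ g.support) (hlt : t.lo.lt v u) :
    t.IsReducedPair (fun a b => binom K a b ∈ I) u v := by
  have key : ∀ a b, binom K a b ∈ I → t.lo.lt b a → ∀ c ∈ g.support, a ≤ c → u ≤ a := by
    intro a b hab hba c hc hac
    have hl := t.leadExp_binom_left (K := K) hba
    obtain ⟨g', hg', hle⟩ := h.exists_leadExp_le hab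
      (by rw [hl]; exact mem_support_binom_left (@ne_of_gt _ t.lo.toPreorder _ _ hba))
    rw [hl] at hle
    by_cases hgg : g' = g
    · rw [← hu, ← hgg]; exact hle
    · exact absurd (hle.trans hac) (h.2.2 g hg g' hg' hgg c hc)
  refine ⟨hlt, fun a b hab hba => ⟨fun hav => ?_, fun hau => ?_⟩⟩
  · exact t.not_lt_of_le (t.le_of_dvd ((key a b hab hba v hvs hav).trans hav)) hlt
  · exact le_antisymm hau (key a b hab hba u hus hau)

lemma isReducedPair_of_mem_universalGB {I : Ideal (MvPolynomial σ K)} {u v : σ →₀ ℕ}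
    (h : binom K u v ∈ UniversalGB I) :
    binom K u v ∈ I ∧ ∃ t : TermOrder σ, t.IsReducedPair (fun a b => binom K a b ∈ I) u v ∨
      t.IsReducedPair (fun a b => binom K a b ∈ I) v u := by
  obtain ⟨t, 𝒢, h𝒢, hg⟩ := h
  refine ⟨h𝒢.1.1 hg, t, ?_⟩
  have hne : u ≠ v := by
    rintro rfl
    have := h𝒢.2.1 _ hg
    simp [binom] at this
  have hul := mem_support_binom_left (K := K) hne
  have hvl := mem_support_binom_right (K := K) hne
  rcases @lt_or_gt_of_ne _ t.lo _ _ hne with hlt | hlt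
  · exact Or.inr (h𝒢.isReducedPair hg (t.leadExp_binom_right hlt) hvl hul hlt)
  · exact Or.inl (h𝒢.isReducedPair hg (t.leadExp_binom_left hlt) hul hvl hlt)

/-! ### Vertex degrees of edge monomials -/

/-- The exponent vector of `x_a x_b` for an edge `{a, b}`. -/
def edgeVec (e : Sym2 V) : V →₀ ℕ :=
  Sym2.lift ⟨fun a b => Finsupp.single a 1 + Finsupp.single b 1, fun _ _ => add_comm _ _⟩ e

lemma edgeVec_mk (a b : V) : edgeVec s(a, b) = Finsupp.single a 1 + Finsupp.single b 1 := rfl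

lemma edgeImage_eq (e : Sym2 V) : edgeImage K e = monomial (edgeVec e) 1 := by
  induction e using Sym2.ind with
  | _ a b => simp [edgeImage, edgeVec_mk, X, monomial_mul]

lemma edgeVec_apply_eq_zero {e : Sym2 V} {x : V} (h : x ∉ e) : edgeVec e x = 0 := by
  classical
  induction e using Sym2.ind with
  | _ a b =>
    simp only [Sym2.mem_iff, not_or] at h
    simp [edgeVec_mk, Ne.symm h.1, Ne.symm h.2]

lemma edgeVec_apply_pos {e : Sym2 V} {x : V} (h : x ∈ e) : 0 < edgeVec e x := by
  classical
  induction e using Sym2.ind with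
  | _ a b =>
    rcases Sym2.mem_iff.mp h with rfl | rfl <;> simp [edgeVec_mk]

/-- The exponent vector of the image of an edge monomial. -/
def vertexDeg (G : SimpleGraph V) : (G.edgeSet →₀ ℕ) →+ (V →₀ ℕ) :=
  Finsupp.liftAddHom fun e => multiplesHom _ (edgeVec (e : Sym2 V))

section vertexDeg

variable {G : SimpleGraph V}

lemma vertexDeg_single (e : G.edgeSet) (k : ℕ) :
    vertexDeg G (Finsupp.single e k) = k • edgeVec (e : Sym2 V) := by
  simp [vertexDeg]

lemma vertexDeg_apply (u : G.edgeSet →₀ ℕ) (x : V) :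
    vertexDeg G u x = ∑ e ∈ u.support, u e * edgeVec (e : Sym2 V) x := by
  simp [vertexDeg, Finsupp.liftAddHom_apply, Finsupp.sum, Finsupp.finsetSum_apply]

lemma vertexDeg_mono {u v : G.edgeSet →₀ ℕ} (h : u ≤ v) (x : V) :
    vertexDeg G u x ≤ vertexDeg G v x := by
  obtain ⟨w, rfl⟩ := exists_add_of_le h
  simp

lemma exists_edge_of_vertexDeg_lt {u v : G.edgeSet →₀ ℕ} (h : u ≤ v) {x : V}
    (hx : vertexDeg G u x < vertexDeg G v x) : ∃ e : G.edgeSet, u + Finsupp.single e 1 ≤ v ∧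
      ∃ y, edgeVec (e : Sym2 V) = Finsupp.single x 1 + Finsupp.single y 1 := by
  classical
  obtain ⟨w, rfl⟩ := exists_add_of_le h
  have hw : vertexDeg G w x ≠ 0 := by
    rw [map_add, Finsupp.add_apply] at hx
    omega
  rw [vertexDeg_apply] at hw
  obtain ⟨e, he, hne⟩ := Finset.exists_ne_zero_of_sum_ne_zero hw
  refine ⟨e, ?_, ?_⟩
  · rw [add_le_add_iff_left, Finsupp.single_le_iff]
    exact Nat.one_le_iff_ne_zero.mpr (Finsupp.mem_support_iff.mp he)
  · have hxe : x ∈ (e : Sym2 V) := by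
      by_contra hc
      simp [edgeVec_apply_eq_zero hc] at hne
    obtain ⟨y, hy⟩ := hxe
    exact ⟨y, by rw [hy, edgeVec_mk]⟩

lemma eq_of_le_of_vertexDeg_eq {u v : G.edgeSet →₀ ℕ} (h : u ≤ v)
    (hd : vertexDeg G u = vertexDeg G v) : u = v := by
  obtain ⟨w, rfl⟩ := exists_add_of_le h
  suffices w = 0 by simp [this]
  by_contra hw
  obtain ⟨e, he⟩ := Finsupp.support_nonempty_iff.mpr hw
  obtain ⟨x, hx⟩ : ∃ x, x ∈ (e : Sym2 V) := ⟨_, Sym2.out_fst_mem _⟩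
  have h1 : vertexDeg G w = 0 := by simpa using hd.symm
  have h2 : vertexDeg G w x = 0 := by rw [h1]; rfl
  rw [vertexDeg_apply, Finset.sum_eq_zero_iff] at h2
  have h3 := h2 e he
  have h4 := edgeVec_apply_pos hx
  have h5 := Finsupp.mem_support_iff.mp he
  rcases Nat.mul_eq_zero.mp h3 with h | h <;> omega

lemma aeval_monomial_edge (u : G.edgeSet →₀ ℕ) :
    MvPolynomial.aeval (fun e : G.edgeSet => edgeImage K (e : Sym2 V)) (monomial u (1 : K)) =
      monomial (vertexDeg G u) 1 := by
  rw [aeval_monomial, map_one, one_mul]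
  induction u using Finsupp.induction_linear with
  | zero => simp
  | add f g hf hg =>
    rw [Finsupp.prod_add_index' (by simp) (by intros; rw [pow_add]), hf, hg, map_add,
      monomial_mul, one_mul]
  | single a b =>
    rw [Finsupp.prod_single_index (by simp), vertexDeg_single, edgeImage_eq, monomial_pow, one_pow]

lemma binom_mem_graphToricIdeal_iff (u v : G.edgeSet →₀ ℕ) :
    binom K u v ∈ graphToricIdeal K G ↔ vertexDeg G u = vertexDeg G v := by
  rw [graphToricIdeal, RingHom.mem_ker]
  change MvPolynomial.aeval (fun e : G.edgeSet => edgeImage K (e : Sym2 V)) (binom K u v) = 0 ↔ _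
  rw [binom, map_sub, aeval_monomial_edge, aeval_monomial_edge, sub_eq_zero]
  constructor
  · intro h
    exact (monomial_left_injective (one_ne_zero : (1 : K) ≠ 0)) h
  · intro h; rw [h]

/-- Alternately using edges of `M` and of `P`, one walks from `a` back to `a`. -/
lemma exists_alternating_aux {M P : G.edgeSet →₀ ℕ} {a : V}
    (hne : ∀ x, x ≠ a → vertexDeg G M x = vertexDeg G P x)
    (ha : vertexDeg G P a < vertexDeg G M a) (n : ℕ) :
    ∀ (M' P' : G.edgeSet →₀ ℕ) (x : V), M' ≤ M → P' ≤ P → M.degree < M'.degree + n →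
      vertexDeg G M' + Finsupp.single x 1 = vertexDeg G P' + Finsupp.single a 1 →
      ∃ M'' ≤ M, ∃ P'' ≤ P, vertexDeg G M'' = vertexDeg G P'' + Finsupp.single a 2 := by
  classical
  induction n with
  | zero =>
    intro M' P' x hM hP hd _
    obtain ⟨w, rfl⟩ := exists_add_of_le hM
    simp at hd
  | succ n ih =>
    intro M' P' x hM hP hd h
    have hx : vertexDeg G M' x < vertexDeg G M x := by
      have h1 := DFunLike.congr_fun h x
      have h2 := vertexDeg_mono hP x
      by_cases hxa : x = a
      · subst hxa
        simp at h1
        omega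
      · simp [Ne.symm hxa] at h1
        have := hne x hxa
        omega
    obtain ⟨e, he, y, hy⟩ := exists_edge_of_vertexDeg_lt hM hx
    have h' : vertexDeg G (M' + Finsupp.single e 1) =
        vertexDeg G P' + Finsupp.single a 1 + Finsupp.single y 1 := by
      rw [map_add, vertexDeg_single, one_smul, hy, ← add_assoc, h]
    by_cases hya : y = a
    · subst hya
      refine ⟨_, he, P', hP, ?_⟩
      rw [h', add_assoc, ← Finsupp.single_add]
    · have hy' : vertexDeg G P' y < vertexDeg G P y := by
        have h1 := DFunLike.congr_fun h' y
        have h2 := vertexDeg_mono he y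
        have h3 := hne y hya
        simp only [Finsupp.add_apply, Finsupp.single_eq_same] at h1
        omega
      obtain ⟨e', he', z, hz⟩ := exists_edge_of_vertexDeg_lt hP hy'
      refine ih _ _ z he he' ?_ ?_
      · rw [map_add, Finsupp.degree_single]
        omega
      · rw [h', map_add, vertexDeg_single, one_smul, hz]
        abel

lemma exists_alternating {M P : G.edgeSet →₀ ℕ} {a : V}
    (hne : ∀ x, x ≠ a → vertexDeg G M x = vertexDeg G P x)
    (ha : vertexDeg G P a < vertexDeg G M a) :
    ∃ M' ≤ M, ∃ P' ≤ P, vertexDeg G M' = vertexDeg G P' + Finsupp.single a 2 :=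
  exists_alternating_aux hne ha (M.degree + 1) 0 0 a (zero_le) (zero_le) (by simp) (by simp)

end vertexDeg

/-! ### Blocks -/

lemma IsBiconnected.reachable_of_ne {B : SimpleGraph V} (hB : IsBiconnected B) {a b x : V}
    (ha : a ∈ B.support) (hb : b ∈ B.support) (hax : a ≠ x) (hbx : b ≠ x) :
    (SimpleGraph.fromEdgeSet {e | e ∈ B.edgeSet ∧ x ∉ e}).Reachable a b := by
  by_contra h
  exact hB.2.2 x ⟨a, b, hax, hbx, hB.2.1 a ha b hb, h⟩

/-- Distinct vertices of a block are not joined by a path that uses no edge of the block. -/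
lemma IsBlock.not_reachable_sdiff {H B : SimpleGraph V} (h : IsBlock H B) {a b : V}
    (ha : a ∈ B.support) (hb : b ∈ B.support) (hab : a ≠ b) : ¬ (H \ B).Reachable a b := by
  classical
  intro hr
  obtain ⟨p, hp⟩ := hr.exists_isPath
  set B' : SimpleGraph V := B ⊔ SimpleGraph.fromEdgeSet {e | e ∈ p.edges} with hB'
  have hle : B ≤ B' := le_sup_left
  have hpB' : ∀ e ∈ p.edges, e ∈ B'.edgeSet := by
    intro e he
    rw [hB', SimpleGraph.edgeSet_sup, SimpleGraph.edgeSet_fromEdgeSet]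
    exact Or.inr ⟨he, (H \ B).not_isDiag_of_mem_edgeSet (p.edges_subset_edgeSet he)⟩
  have hB'H : B' ≤ H := by
    refine sup_le h.1 ?_
    intro c d hcd
    rw [SimpleGraph.fromEdgeSet_adj] at hcd
    exact (p.adj_of_mem_edges hcd.1).1
  have hsupp : ∀ c ∈ B'.support, c ∈ B.support ∨ c ∈ p.support := by
    rintro c ⟨d, hcd⟩
    change (B ⊔ SimpleGraph.fromEdgeSet {e | e ∈ p.edges}).Adj c d at hcd
    rw [SimpleGraph.sup_adj, SimpleGraph.fromEdgeSet_adj] at hcd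
    rcases hcd with hcd | hcd
    · exact Or.inl ⟨d, hcd⟩
    · exact Or.inr (p.fst_mem_support_of_mem_edges hcd.1)
  have hseg : ∀ (x c d : V) (q : (H \ B).Walk c d), q.edges ⊆ p.edges → x ∉ q.support →
      (SimpleGraph.fromEdgeSet {e | e ∈ B'.edgeSet ∧ x ∉ e}).Reachable c d := by
    intro x c d q hq hx
    refine ⟨q.transfer _ fun e he => ?_⟩
    rw [SimpleGraph.edgeSet_fromEdgeSet]
    refine ⟨⟨hpB' e (hq he), fun hxe => hx ?_⟩,
      (H \ B).not_isDiag_of_mem_edgeSet (q.edges_subset_edgeSet he)⟩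
    exact q.mem_support_of_mem_edges he hxe
  have hto : ∀ x, ∀ c ∈ B'.support, c ≠ x → ∃ d ∈ B.support, d ≠ x ∧
      (SimpleGraph.fromEdgeSet {e | e ∈ B'.edgeSet ∧ x ∉ e}).Reachable c d := by
    intro x c hc hcx
    rcases hsupp c hc with hc | hc
    · exact ⟨c, hc, hcx, SimpleGraph.Reachable.refl _⟩
    · by_cases hx : x ∈ (p.takeUntil c hc).support
      · have hx' : x ∉ (p.dropUntil c hc).support := by
          intro hx'
          have hnd := hp.support_nodup
          rw [← p.take_spec hc, SimpleGraph.Walk.support_append,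
            List.nodup_append] at hnd
          rw [← SimpleGraph.Walk.cons_tail_support, List.mem_cons] at hx'
          rcases hx' with rfl | hx'
          · exact hcx rfl
          · exact hnd.2.2 x hx x hx' rfl
        refine ⟨b, hb, ?_, hseg x c b _ (p.edges_dropUntil_subset_edges hc) hx'⟩
        rintro rfl
        exact hx' (SimpleGraph.Walk.end_mem_support _)
      · refine ⟨a, ha, ?_, (hseg x a c _ (p.edges_takeUntil_subset_edges hc) hx).symm⟩
        rintro rfl
        exact hx (SimpleGraph.Walk.start_mem_support _)
  have hmono : ∀ x, SimpleGraph.fromEdgeSet {e | e ∈ B.edgeSet ∧ x ∉ e} ≤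
      SimpleGraph.fromEdgeSet {e | e ∈ B'.edgeSet ∧ x ∉ e} := fun x =>
    SimpleGraph.fromEdgeSet_mono fun e he => ⟨SimpleGraph.edgeSet_mono hle he.1, he.2⟩
  have hdel : ∀ x, ∀ c ∈ B'.support, ∀ d ∈ B'.support, c ≠ x → d ≠ x →
      (SimpleGraph.fromEdgeSet {e | e ∈ B'.edgeSet ∧ x ∉ e}).Reachable c d := by
    intro x c hc d hd hcx hdx
    obtain ⟨c', hc', hcx', hcr⟩ := hto x c hc hcx
    obtain ⟨d', hd', hdx', hdr⟩ := hto x d hd hdx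
    exact hcr.trans (((h.2.1.reachable_of_ne hc' hd' hcx' hdx').mono (hmono x)).trans hdr.symm)
  have hreach : ∀ c ∈ B'.support, B'.Reachable c a := by
    intro c hc
    rcases hsupp c hc with hc | hc
    · exact (h.2.1.2.1 c hc a ha).mono hle
    · exact ⟨((p.takeUntil c hc).transfer B' fun e he =>
        hpB' e (p.edges_takeUntil_subset_edges hc he)).reverse⟩
  have hsupp_of : ∀ c d, B'.Reachable c d → c ≠ d → c ∈ B'.support := by
    rintro c d ⟨q⟩ hcd
    cases q with
    | nil => exact absurd rfl hcd
    | cons hadj _ => exact ⟨_, hadj⟩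
  have hbi : IsBiconnected B' := by
    refine ⟨h.2.1.1.mono (SimpleGraph.edgeSet_mono hle), fun c hc d hd =>
      (hreach c hc).trans (hreach d hd).symm, ?_⟩
    rintro x ⟨c, d, hcx, hdx, hcd, hn⟩
    by_cases hcd' : c = d
    · subst hcd'
      exact hn (SimpleGraph.Reachable.refl _)
    · exact hn (hdel x c (hsupp_of c d hcd hcd') d (hsupp_of d c hcd.symm (Ne.symm hcd')) hcx hdx)
  have hEq := h.2.2 B' hle hB'H hbi
  cases p with
  | nil => exact hab rfl
  | @cons _ c _ hadj q =>
    have h1 := hpB' s(a, c) (by simp)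
    rw [hEq, SimpleGraph.mem_edgeSet] at h1
    exact hadj.2 h1

/-! ### Sums over ranges -/

section RangeSums

variable {N : Type*} [AddCommMonoid N]

lemma sum_range_shift_of_periodic [IsRightCancelAdd N] {f : ℕ → N} {n : ℕ} (hf : ∀ i, f (i + n) = f i) (k : ℕ) :
    ∑ j ∈ Finset.range n, f (k + j) = ∑ j ∈ Finset.range n, f j := by
  induction k with
  | zero => simp
  | succ k ih =>
    rw [← ih]
    have h1 := Finset.sum_range_succ (fun j => f (k + j)) n
    rw [Finset.sum_range_succ', hf, add_zero] at h1
    rw [← add_right_cancel h1]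
    exact Finset.sum_congr rfl fun j _ => by rw [add_assoc, add_comm 1 j]

lemma sum_range_two_mul (f : ℕ → N) (m : ℕ) : ∑ j ∈ Finset.range (2 * m), f j =
    ∑ k ∈ Finset.range m, f (2 * k) + ∑ k ∈ Finset.range m, f (2 * k + 1) := by
  induction m with
  | zero => simp
  | succ m ih =>
    rw [Nat.mul_succ, Finset.sum_range_succ, Finset.sum_range_succ, ih, Finset.sum_range_succ,
      Finset.sum_range_succ]
    abel

lemma sum_range_nat_le_of_unique {ι : Type*} {s : Finset ι} {f : ι → ℕ} {c : ℕ}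
    (hle : ∀ i ∈ s, f i ≤ c) (huniq : ∀ i ∈ s, ∀ j ∈ s, f i ≠ 0 → f j ≠ 0 → i = j) :
    ∑ i ∈ s, f i ≤ c := by
  by_cases h : ∃ i ∈ s, f i ≠ 0
  · obtain ⟨i, hi, hne⟩ := h
    rw [Finset.sum_eq_single_of_mem i hi fun j hj hji => by
      by_contra hj0
      exact hji (huniq j hj i hi hj0 hne)]
    exact hle i hi
  · push Not at h
    rw [Finset.sum_eq_zero h]
    exact Nat.zero_le c

end RangeSums

/-! ### Decomposing a binomial along a pure cycle -/

/-- A cycle with vertices `x i` and edges `e i`, together with monomials `P (x i)` and `M (x i)`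
which differ by the square of the vertex `x i`. -/
structure CycleDecomposition (G : SimpleGraph V) where
  n : ℕ
  three_le : 3 ≤ n
  e : ℕ → G.edgeSet
  x : ℕ → V
  P : V → G.edgeSet →₀ ℕ
  M : V → G.edgeSet →₀ ℕ
  e_periodic : ∀ i, e (i + n) = e i
  x_periodic : ∀ i, x (i + n) = x i
  coe_e : ∀ i, (e i : Sym2 V) = s(x i, x (i + 1))
  e_inj : ∀ i j, i < n → j < n → e i = e j → i = j
  deg_eq : ∀ i, vertexDeg G (M (x i)) = vertexDeg G (P (x i)) + Finsupp.single (x i) 2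

namespace CycleDecomposition

variable {G : SimpleGraph V} (D : CycleDecomposition G)

/-- The product of the edges of the cycle and of the monomials `P (x i)`. -/
def left : G.edgeSet →₀ ℕ :=
  ∑ i ∈ Finset.range D.n, Finsupp.single (D.e i) 1 + ∑ i ∈ Finset.range D.n, D.P (D.x i)

/-- The product of the monomials `M (x i)`. -/
def right : G.edgeSet →₀ ℕ :=
  ∑ i ∈ Finset.range D.n, D.M (D.x i)

lemma left_eq : D.left =
    ∑ i ∈ Finset.range D.n, Finsupp.single (D.e i) 1 + ∑ i ∈ Finset.range D.n, D.P (D.x i) := rfl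

lemma right_eq : D.right = ∑ i ∈ Finset.range D.n, D.M (D.x i) := rfl

lemma vertexDeg_e (i : ℕ) : vertexDeg G (Finsupp.single (D.e i) 1) =
    Finsupp.single (D.x i) 1 + Finsupp.single (D.x (i + 1)) 1 := by
  rw [vertexDeg_single, one_smul, D.coe_e, edgeVec_mk]

lemma vertexDeg_left : vertexDeg G D.left = vertexDeg G D.right := by
  have h := sum_range_shift_of_periodic (f := fun i => Finsupp.single (D.x i) (1 : ℕ))
    (fun j => by rw [D.x_periodic]) 1
  simp only [add_comm 1] at h
  simp only [left_eq, right_eq, map_add, map_sum, D.deg_eq, D.vertexDeg_e,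
    Finset.sum_add_distrib, h]
  simp only [show (2 : ℕ) = 1 + 1 from rfl, Finsupp.single_add, Finset.sum_add_distrib]
  abel

lemma M_ne_zero (i : ℕ) : D.M (D.x i) ≠ 0 := by
  intro h
  have h1 := DFunLike.congr_fun (D.deg_eq i) (D.x i)
  simp [h] at h1

lemma sum_ne_zero (f : ℕ → ℕ) {m : ℕ} (hm : 0 < m) :
    ∑ k ∈ Finset.range m, Finsupp.single (D.e (f k)) (1 : ℕ) ≠ 0 := by
  intro h
  have h1 := congrArg Finsupp.degree h
  rw [map_sum] at h1
  simp at h1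
  omega

/-- The trailing exponent of a binomial in a reduced Gröbner basis is not the side with the
pure cycle. -/
lemma not_isReducedPair_right (t : TermOrder G.edgeSet) :
    ¬ t.IsReducedPair (fun a b => vertexDeg G a = vertexDeg G b) D.right D.left := by
  rintro ⟨hlt, h⟩
  have hstep : ∀ i, t.lo.le (D.M (D.x i) + D.M (D.x (i + 1)))
      (D.P (D.x i) + D.P (D.x (i + 1)) + (Finsupp.single (D.e i) 1 + Finsupp.single (D.e i) 1)) := by
    intro i
    apply t.le_of_not_lt
    intro hlt'
    have hdeg : vertexDeg G (D.M (D.x i) + D.M (D.x (i + 1))) = vertexDeg G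
        (D.P (D.x i) + D.P (D.x (i + 1)) +
          (Finsupp.single (D.e i) 1 + Finsupp.single (D.e i) 1)) := by
      simp only [map_add, D.deg_eq, D.vertexDeg_e]
      rw [show (2 : ℕ) = 1 + 1 from rfl, Finsupp.single_add, Finsupp.single_add]
      abel
    have hv : D.right = D.M (D.x i) + D.M (D.x (i + 1)) +
        ∑ j ∈ Finset.range (D.n - 2), D.M (D.x (i + (j + 2))) := by
      rw [D.right_eq, ← sum_range_shift_of_periodic (f := fun i => D.M (D.x i))
        (fun j => by rw [D.x_periodic]) i]
      obtain ⟨k, hk⟩ := Nat.exists_eq_add_of_le D.three_le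
      rw [show D.n = (k + 1) + 1 + 1 by omega, Finset.sum_range_succ', Finset.sum_range_succ']
      simp only [add_zero, zero_add, add_assoc, Nat.reduceAdd,
        Nat.reduceSubDiff]
      abel
    have heq := (h _ _ hdeg hlt').2 (by
      rw [hv]
      exact le_self_add)
    rw [hv] at heq
    have h0 : ∑ j ∈ Finset.range (D.n - 2), D.M (D.x (i + (j + 2))) = 0 := by
      simpa using heq
    rw [Finset.sum_eq_zero_iff] at h0
    exact D.M_ne_zero _ (h0 0 (by have := D.three_le; simp; omega))
  have hsum := t.sum_le_sum (Finset.range D.n) fun i _ => hstep i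
  have hM := sum_range_shift_of_periodic (f := fun i => D.M (D.x i))
    (fun j => by rw [D.x_periodic]) 1
  have hP := sum_range_shift_of_periodic (f := fun i => D.P (D.x i))
    (fun j => by rw [D.x_periodic]) 1
  simp only [add_comm 1] at hM hP
  have hu2 : ∑ i ∈ Finset.range D.n, (D.P (D.x i) + D.P (D.x (i + 1)) +
      (Finsupp.single (D.e i) 1 + Finsupp.single (D.e i) 1)) = D.left + D.left := by
    simp only [Finset.sum_add_distrib, hP, D.left_eq]
    abel
  rw [hu2, Finset.sum_add_distrib, hM, ← D.right_eq] at hsum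
  exact t.not_lt_of_le (t.le_of_add_self_le hsum) hlt

lemma vertexDeg_alternating (i m : ℕ) :
    vertexDeg G (∑ k ∈ Finset.range m, Finsupp.single (D.e (i + 2 * k)) 1) +
        Finsupp.single (D.x (i + 2 * m)) 1 =
      vertexDeg G (∑ k ∈ Finset.range m, Finsupp.single (D.e (i + (2 * k + 1))) 1) +
        Finsupp.single (D.x i) 1 := by
  induction m with
  | zero => simp
  | succ m ih =>
    simp only [Finset.sum_range_succ, map_add, D.vertexDeg_e] at ih ⊢
    rw [show i + 2 * (m + 1) = i + (2 * m + 1) + 1 by ring,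
      show i + 2 * m + 1 = i + (2 * m + 1) by ring]
    calc _ = (vertexDeg G (∑ k ∈ Finset.range m, Finsupp.single (D.e (i + 2 * k)) 1) +
          Finsupp.single (D.x (i + 2 * m)) 1) + Finsupp.single (D.x (i + (2 * m + 1))) 1 +
          Finsupp.single (D.x (i + (2 * m + 1) + 1)) 1 := by abel
      _ = _ := by rw [ih]; abel

lemma sum_e_shift (i : ℕ) : ∑ j ∈ Finset.range D.n, Finsupp.single (D.e (i + j)) 1 =
    ∑ j ∈ Finset.range D.n, Finsupp.single (D.e j) 1 :=
  sum_range_shift_of_periodic (f := fun j => Finsupp.single (D.e j) 1)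
    (fun j => by rw [D.e_periodic]) i

/-- The leading exponent of a binomial in a reduced Gröbner basis is not the side with a pure
cycle of even length. -/
lemma not_isReducedPair_left_of_even (t : TermOrder G.edgeSet) {m : ℕ} (hm : D.n = 2 * m) :
    ¬ t.IsReducedPair (fun a b => vertexDeg G a = vertexDeg G b) D.left D.right := by
  classical
  rintro ⟨-, h⟩
  have hn := D.three_le
  set L := ∑ k ∈ Finset.range m, Finsupp.single (D.e (2 * k)) (1 : ℕ) with hL
  set R := ∑ k ∈ Finset.range m, Finsupp.single (D.e (2 * k + 1)) (1 : ℕ) with hR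
  have hu : D.left = L + R + ∑ i ∈ Finset.range D.n, D.P (D.x i) := by
    rw [hL, hR, ← sum_range_two_mul (fun j => Finsupp.single (D.e j) (1 : ℕ)), ← hm, ← D.left_eq]
  have hdeg : vertexDeg G L = vertexDeg G R := by
    have h1 := D.vertexDeg_alternating 0 m
    have h2 := D.x_periodic 0
    simp only [zero_add] at h1 h2
    rw [← hm, h2] at h1
    exact add_right_cancel h1
  have hL0 : L ≠ 0 := D.sum_ne_zero (fun k => 2 * k) (by omega)
  have hR0 : R ≠ 0 := D.sum_ne_zero (fun k => 2 * k + 1) (by omega)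
  have hne : L ≠ R := by
    intro hLR
    have h1 := DFunLike.congr_fun hLR (D.e 0)
    have h2 : R (D.e 0) = 0 := by
      rw [hR, Finsupp.finsetSum_apply]
      refine Finset.sum_eq_zero fun k hk => ?_
      rw [Finset.mem_range] at hk
      refine Finsupp.single_eq_of_ne fun hc => ?_
      have := D.e_inj _ _ (by omega) (by omega) hc
      omega
    have h3 : 0 < L (D.e 0) := by
      rw [hL, Finsupp.finsetSum_apply]
      exact Finset.sum_pos' (fun _ _ => Nat.zero_le _) ⟨0, by simp; omega, by simp⟩
    omega
  rcases @lt_or_gt_of_ne _ t.lo _ _ hne with hlt | hlt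
  · have heq := (h _ _ hdeg.symm hlt).2 (by
      rw [hu, add_comm L R, add_assoc]
      exact le_self_add)
    rw [hu, add_comm L R, add_assoc] at heq
    have h0 := left_eq_add.mp heq
    exact hL0 (add_eq_zero.mp h0).1
  · have heq := (h _ _ hdeg hlt).2 (by
      rw [hu, add_assoc]
      exact le_self_add)
    rw [hu, add_assoc] at heq
    have h0 := left_eq_add.mp heq
    exact hR0 (add_eq_zero.mp h0).1

/-- The leading exponent of a binomial in a reduced Gröbner basis is not the side with a pure
cycle of odd length. -/
lemma not_isReducedPair_left_of_odd (t : TermOrder G.edgeSet) {m : ℕ} (hm : D.n = 2 * m + 1) :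
    ¬ t.IsReducedPair (fun a b => vertexDeg G a = vertexDeg G b) D.left D.right := by
  classical
  rintro ⟨hlt, h⟩
  have hn := D.three_le
  set L : ℕ → G.edgeSet →₀ ℕ := fun i =>
    ∑ k ∈ Finset.range (m + 1), Finsupp.single (D.e (i + 2 * k)) (1 : ℕ) with hL
  set R : ℕ → G.edgeSet →₀ ℕ := fun i =>
    ∑ k ∈ Finset.range m, Finsupp.single (D.e (i + (2 * k + 1))) (1 : ℕ) with hR
  have hLR : ∀ i, L i + R i = ∑ j ∈ Finset.range D.n, Finsupp.single (D.e j) 1 := by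
    intro i
    rw [← D.sum_e_shift i, hm, Finset.sum_range_succ,
      sum_range_two_mul (fun j => Finsupp.single (D.e (i + j)) (1 : ℕ))]
    simp only [hL, hR, Finset.sum_range_succ]
    abel
  have hstep : ∀ i ∈ Finset.range D.n,
      t.lo.le (L i + D.P (D.x i)) (R i + D.M (D.x i)) := by
    intro i hi
    apply t.le_of_not_lt
    intro hlt'
    have hdeg : vertexDeg G (L i + D.P (D.x i)) = vertexDeg G (R i + D.M (D.x i)) := by
      have h1 := D.vertexDeg_alternating i m
      have h2 := D.x_periodic i
      rw [hm, ← add_assoc] at h2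
      simp only [hL, hR, Finset.sum_range_succ, map_add, D.vertexDeg_e, D.deg_eq, h2]
      rw [← add_assoc, h1, show (2 : ℕ) = 1 + 1 from rfl, Finsupp.single_add]
      abel
    have hu : D.left = L i + D.P (D.x i) +
        (R i + ∑ j ∈ (Finset.range D.n).erase i, D.P (D.x j)) := by
      rw [D.left_eq, ← hLR i, ← Finset.add_sum_erase _ _ hi]
      abel
    have heq := (h _ _ hdeg hlt').2 (by
      rw [hu]
      exact le_self_add)
    rw [hu] at heq
    have h0 := left_eq_add.mp heq
    exact D.sum_ne_zero (fun k => i + (2 * k + 1)) (by omega) (add_eq_zero.mp h0).1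
  have hsum := t.sum_le_sum _ hstep
  set S := ∑ j ∈ Finset.range D.n, Finsupp.single (D.e j) (1 : ℕ) with hS
  have hshift : ∀ k, ∑ i ∈ Finset.range D.n, Finsupp.single (D.e (i + k)) 1 = S := by
    intro k
    simp only [add_comm _ k]
    exact D.sum_e_shift k
  have hLsum : ∑ i ∈ Finset.range D.n, L i = (m + 1) • S := by
    rw [Finset.sum_comm]
    simp [hshift]
  have hRsum : ∑ i ∈ Finset.range D.n, R i = m • S := by
    rw [Finset.sum_comm]
    simp [hshift]
  rw [Finset.sum_add_distrib, Finset.sum_add_distrib, hLsum, hRsum, ← D.right_eq, succ_nsmul,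
    add_assoc, hS, ← D.left_eq, add_comm, add_comm _ D.right] at hsum
  exact t.not_lt_of_le (t.le_of_add_le_add_right hsum) hlt

lemma not_isReducedPair_left (t : TermOrder G.edgeSet) :
    ¬ t.IsReducedPair (fun a b => vertexDeg G a = vertexDeg G b) D.left D.right := by
  rcases Nat.even_or_odd' D.n with ⟨m, hm | hm⟩
  · exact D.not_isReducedPair_left_of_even t hm
  · exact D.not_isReducedPair_left_of_odd t hm

end CycleDecomposition

/-! ### Pure cyclic blocks give cycle decompositions -/

/-- Only the pair `(u, v)` itself divides `(u, v)` among nontrivial pairs related by `r`. -/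
def IsPrimitivePair (r : (σ →₀ ℕ) → (σ →₀ ℕ) → Prop) (u v : σ →₀ ℕ) : Prop :=
  u ≠ v ∧ ∀ a b, r a b → a ≠ b → a ≤ u → b ≤ v → a = u ∧ b = v

section

variable {G : SimpleGraph V}

lemma vertexDeg_apply_eq_zero {u : G.edgeSet →₀ ℕ} {x : V}
    (h : ∀ e ∈ u.support, x ∉ (e : Sym2 V)) : vertexDeg G u x = 0 := by
  rw [vertexDeg_apply]
  exact Finset.sum_eq_zero fun e he => by rw [edgeVec_apply_eq_zero (h e he), mul_zero]

lemma vertexDeg_apply_pos {u : G.edgeSet →₀ ℕ} {x : V} {e : G.edgeSet} (he : e ∈ u.support)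
    (hx : x ∈ (e : Sym2 V)) : 0 < vertexDeg G u x := by
  rw [vertexDeg_apply]
  exact Finset.sum_pos' (fun _ _ => Nat.zero_le _)
    ⟨e, he, Nat.mul_pos (Nat.pos_of_ne_zero (Finsupp.mem_support_iff.mp he)) (edgeVec_apply_pos hx)⟩

lemma TermOrder.IsReducedPair.isPrimitivePair {t : TermOrder G.edgeSet} {u v : G.edgeSet →₀ ℕ}
    (h : t.IsReducedPair (fun a b => vertexDeg G a = vertexDeg G b) u v)
    (huv : vertexDeg G u = vertexDeg G v) :
    IsPrimitivePair (fun a b => vertexDeg G a = vertexDeg G b) u v := by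
  refine ⟨@ne_of_gt _ t.lo.toPreorder _ _ h.1, fun a b hab hne hau hbv => ?_⟩
  rcases @lt_or_gt_of_ne _ t.lo _ _ hne with hlt | hlt
  · exact absurd hbv (h.2 b a hab.symm hlt).1
  · have hau' := (h.2 a b hab hlt).2 hau
    subst hau'
    exact ⟨rfl, eq_of_le_of_vertexDeg_eq hbv (hab.symm.trans huv)⟩

lemma IsPrimitivePair.symm {u v : G.edgeSet →₀ ℕ}
    (h : IsPrimitivePair (fun a b => vertexDeg G a = vertexDeg G b) u v) :
    IsPrimitivePair (fun a b => vertexDeg G a = vertexDeg G b) v u :=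
  ⟨h.1.symm, fun a b hab hne ha hb => (h.2 b a hab.symm hne.symm hb ha).symm⟩

lemma IsPrimitivePair.disjoint {u v : G.edgeSet →₀ ℕ}
    (h : IsPrimitivePair (fun a b => vertexDeg G a = vertexDeg G b) u v)
    (huv : vertexDeg G u = vertexDeg G v) {e : G.edgeSet} (he : e ∈ u.support) :
    e ∉ v.support := by
  intro he'
  rw [Finsupp.mem_support_iff, ← Nat.one_le_iff_ne_zero, ← Finsupp.single_le_iff] at he he'
  obtain ⟨a, ha⟩ := exists_add_of_le he
  obtain ⟨b, hb⟩ := exists_add_of_le he'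
  have hab : vertexDeg G a = vertexDeg G b := by
    rw [ha, hb, map_add, map_add] at huv
    exact add_left_cancel huv
  have hne : a ≠ b := by
    rintro rfl
    exact h.1 (ha.trans hb.symm)
  have h1 := (h.2 a b hab hne (by rw [ha]; exact le_add_self) (by rw [hb]; exact le_add_self)).1
  rw [ha] at h1
  have h2 := right_eq_add.mp h1
  simp at h2

lemma reachable_of_mem_edge {H : SimpleGraph V} {e : Sym2 V} (he : e ∈ H.edgeSet) {a b : V}
    (ha : a ∈ e) (hb : b ∈ e) : H.Reachable a b := by
  by_cases hab : a = b
  · rw [hab]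
  · rw [(Sym2.mem_and_mem_iff hab).mp ⟨ha, hb⟩, SimpleGraph.mem_edgeSet] at he
    exact he.reachable

/-- At a vertex `y` of a pure block, the edges outside the block in the component of `y` yield
monomials that differ by the square of `y`. -/
lemma exists_deg_eq_add_single {H B : SimpleGraph V} (hblock : IsBlock H B)
    {u v : G.edgeSet →₀ ℕ} (huv : vertexDeg G u = vertexDeg G v)
    (hu : ∀ e ∈ u.support, (e : Sym2 V) ∈ H.edgeSet)
    (hv : ∀ e ∈ v.support, (e : Sym2 V) ∈ H.edgeSet ∧ (e : Sym2 V) ∉ B.edgeSet)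
    (hB : ∀ e : G.edgeSet, (e : Sym2 V) ∈ B.edgeSet → e ∈ u.support)
    {y : V} (hy : ∃ e : G.edgeSet, (e : Sym2 V) ∈ B.edgeSet ∧ y ∈ (e : Sym2 V)) :
    ∃ M P : G.edgeSet →₀ ℕ, M ≤ v ∧ P ≤ u ∧
      (∀ e ∈ M.support, ∃ z ∈ (e : Sym2 V), (H \ B).Reachable y z) ∧
      (∀ e ∈ P.support, (e : Sym2 V) ∉ B.edgeSet ∧
        ∃ z ∈ (e : Sym2 V), (H \ B).Reachable y z) ∧
      vertexDeg G M = vertexDeg G P + Finsupp.single y 2 := by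
  classical
  obtain ⟨e₀, he₀, hye₀⟩ := hy
  have hsupp : ∀ e ∈ B.edgeSet, ∀ z ∈ e, z ∈ B.support := by
    rintro e he z ⟨z', rfl⟩
    exact ⟨z', he⟩
  set p : G.edgeSet → Prop := fun e => ∃ z ∈ (e : Sym2 V), (H \ B).Reachable y z with hp
  set q : G.edgeSet → Prop := fun e => (e : Sym2 V) ∉ B.edgeSet ∧ p e with hq
  have hprop : ∀ e : G.edgeSet, (e : Sym2 V) ∈ H.edgeSet → (e : Sym2 V) ∉ B.edgeSet →
      ∀ x ∈ (e : Sym2 V), p e → (H \ B).Reachable y x := by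
    rintro e heH heB x hx ⟨z, hz, hyz⟩
    exact hyz.trans (reachable_of_mem_edge
      (by rw [SimpleGraph.edgeSet_sdiff]; exact ⟨heH, heB⟩) hz hx)
  have hMv : v.filter p ≤ v := by
    conv_rhs => rw [← Finsupp.filter_add_filter_not v p]
    exact le_self_add
  have hPu : u.filter q ≤ u := by
    conv_rhs => rw [← Finsupp.filter_add_filter_not u q]
    exact le_self_add
  have hMx : ∀ x, (H \ B).Reachable y x → vertexDeg G (v.filter p) x = vertexDeg G v x := by
    intro x hx
    conv_rhs => rw [← Finsupp.filter_add_filter_not v p, map_add, Finsupp.add_apply]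
    rw [left_eq_add]
    refine vertexDeg_apply_eq_zero fun e he hxe => ?_
    rw [Finsupp.support_filter, Finset.mem_filter] at he
    exact he.2 ⟨x, hxe, hx⟩
  have hMx' : ∀ x, ¬ (H \ B).Reachable y x → vertexDeg G (v.filter p) x = 0 := by
    intro x hx
    refine vertexDeg_apply_eq_zero fun e he hxe => ?_
    rw [Finsupp.support_filter, Finset.mem_filter] at he
    exact hx (hprop e (hv e he.1).1 (hv e he.1).2 x hxe he.2)
  have hPx' : ∀ x, ¬ (H \ B).Reachable y x → vertexDeg G (u.filter q) x = 0 := by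
    intro x hx
    refine vertexDeg_apply_eq_zero fun e he hxe => ?_
    rw [Finsupp.support_filter, Finset.mem_filter] at he
    exact hx (hprop e (hu e he.1) he.2.1 x hxe he.2.2)
  have hsplit : ∀ x, vertexDeg G u x =
      vertexDeg G (u.filter q) x + vertexDeg G (u.filter fun e => ¬ q e) x := by
    intro x
    rw [← Finsupp.add_apply, ← map_add, Finsupp.filter_add_filter_not]
  obtain ⟨M, hM, P, hP, hMP⟩ := exists_alternating (G := G) (M := v.filter p) (P := u.filter q)
    (a := y) (by
      intro x hxy
      by_cases hx : (H \ B).Reachable y x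
      · rw [hMx x hx, ← huv, hsplit, Nat.add_eq_left]
        refine vertexDeg_apply_eq_zero fun e he hxe => ?_
        rw [Finsupp.support_filter, Finset.mem_filter] at he
        by_cases heB : (e : Sym2 V) ∈ B.edgeSet
        · exact hblock.not_reachable_sdiff (hsupp _ he₀ y hye₀) (hsupp _ heB x hxe)
            (Ne.symm hxy) hx
        · exact he.2 ⟨heB, x, hxe, hx⟩
      · rw [hMx' x hx, hPx' x hx]) (by
      rw [hMx y (SimpleGraph.Reachable.refl y), ← huv, hsplit, Nat.lt_add_right_iff_pos]
      refine vertexDeg_apply_pos (e := e₀) ?_ hye₀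
      rw [Finsupp.support_filter, Finset.mem_filter]
      exact ⟨hB e₀ he₀, fun hc => hc.1 he₀⟩)
  refine ⟨M, P, hM.trans hMv, hP.trans hPu, fun e he => ?_, fun e he => ?_, hMP⟩
  · have h1 := Finsupp.support_mono hM he
    rw [Finsupp.support_filter, Finset.mem_filter] at h1
    exact h1.2
  · have h1 := Finsupp.support_mono hP he
    rw [Finsupp.support_filter, Finset.mem_filter] at h1
    exact h1.2

lemma exists_cycleDecomposition {H B : SimpleGraph V} (hBG : B ≤ G) (hblock : IsBlock H B)
    (hcyc : IsCycleGraph B) {u v : G.edgeSet →₀ ℕ} (huv : vertexDeg G u = vertexDeg G v)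
    (hprim : IsPrimitivePair (fun a b => vertexDeg G a = vertexDeg G b) u v)
    (hu : ∀ e ∈ u.support, (e : Sym2 V) ∈ H.edgeSet)
    (hv : ∀ e ∈ v.support, (e : Sym2 V) ∈ H.edgeSet)
    (hB : ∀ e : G.edgeSet, (e : Sym2 V) ∈ B.edgeSet → e ∈ u.support) :
    ∃ D : CycleDecomposition G, D.left = u ∧ D.right = v := by
  classical
  have hv' : ∀ e ∈ v.support, (e : Sym2 V) ∈ H.edgeSet ∧ (e : Sym2 V) ∉ B.edgeSet :=
    fun e he => ⟨hv e he, fun heB => hprim.disjoint huv (hB e heB) he⟩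
  obtain ⟨n, f, hn, hinj, hedge⟩ := hcyc
  set x : ℕ → V := fun i => f (i % n) with hx
  have hxinj : ∀ i j, i < n → j < n → x i = x j → i = j := by
    intro i j hi hj hij
    simp only [hx, Nat.mod_eq_of_lt hi, Nat.mod_eq_of_lt hj] at hij
    exact hinj i j hi hj hij
  have hxper : ∀ i, x (i + n) = x i := fun i => by simp [hx]
  have hxB : ∀ i, s(x i, x (i + 1)) ∈ B.edgeSet := by
    intro i
    rw [hedge]
    exact ⟨i % n, Nat.mod_lt _ (by omega), by simp [hx]⟩
  set e : ℕ → G.edgeSet := fun i => ⟨s(x i, x (i + 1)), SimpleGraph.edgeSet_mono hBG (hxB i)⟩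
    with he
  have heB : ∀ i, (e i : Sym2 V) ∈ B.edgeSet := hxB
  have heinj : ∀ i j, i < n → j < n → e i = e j → i = j := by
    intro i j hi hj hij
    have h1 : s(x i, x (i + 1)) = s(x j, x (j + 1)) := congrArg Subtype.val hij
    rw [Sym2.eq_iff] at h1
    rcases h1 with h1 | ⟨h1, h2⟩
    · exact hxinj i j hi hj h1.1
    · exfalso
      have key : ∀ a b, a < n → b < n → x a = x (b + 1) → a = b + 1 ∨ (a = 0 ∧ b + 1 = n) := by
        intro a b ha hb hab
        rcases Nat.lt_or_ge (b + 1) n with h | h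
        · exact Or.inl (hxinj a (b + 1) ha h hab)
        · have hbn : b + 1 = n := by omega
          have h0 : x (b + 1) = x 0 := by rw [hbn, ← hxper 0, zero_add]
          exact Or.inr ⟨hxinj a 0 ha (by omega) (hab.trans h0), hbn⟩
      have := key i j hi hj h1
      have := key j i hj hi h2.symm
      omega
  have hex : ∀ y : V, ∃ M P : G.edgeSet →₀ ℕ,
      (∃ e : G.edgeSet, (e : Sym2 V) ∈ B.edgeSet ∧ y ∈ (e : Sym2 V)) → M ≤ v ∧ P ≤ u ∧
      (∀ e ∈ M.support, ∃ z ∈ (e : Sym2 V), (H \ B).Reachable y z) ∧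
      (∀ e ∈ P.support, (e : Sym2 V) ∉ B.edgeSet ∧
        ∃ z ∈ (e : Sym2 V), (H \ B).Reachable y z) ∧
      vertexDeg G M = vertexDeg G P + Finsupp.single y 2 := by
    intro y
    by_cases hy : ∃ e : G.edgeSet, (e : Sym2 V) ∈ B.edgeSet ∧ y ∈ (e : Sym2 V)
    · obtain ⟨M, P, h⟩ := exists_deg_eq_add_single hblock huv hu hv' hB hy
      exact ⟨M, P, fun _ => h⟩
    · exact ⟨0, 0, fun h => absurd h hy⟩
  choose M P hMP using hex
  have hxe : ∀ i, ∃ e : G.edgeSet, (e : Sym2 V) ∈ B.edgeSet ∧ x i ∈ (e : Sym2 V) :=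
    fun i => ⟨e i, heB i, Sym2.mem_mk_left _ _⟩
  have hxsupp : ∀ i, x i ∈ B.support := fun i => ⟨x (i + 1), hxB i⟩
  let D : CycleDecomposition G :=
    { n := n
      three_le := hn
      e := e
      x := x
      P := P
      M := M
      e_periodic := fun i => by
        apply Subtype.ext
        simp only [he, hxper, show i + n + 1 = i + 1 + n by ring]
      x_periodic := hxper
      coe_e := fun i => rfl
      e_inj := heinj
      deg_eq := fun i => (hMP (x i) (hxe i)).2.2.2.2 }
  have huniq : ∀ g : G.edgeSet, (g : Sym2 V) ∈ H.edgeSet → (g : Sym2 V) ∉ B.edgeSet →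
      ∀ i < n, ∀ j < n, (∃ z ∈ (g : Sym2 V), (H \ B).Reachable (x i) z) →
      (∃ z ∈ (g : Sym2 V), (H \ B).Reachable (x j) z) → i = j := by
    rintro g hgH hgB i hi j hj ⟨z, hz, hiz⟩ ⟨z', hz', hjz⟩
    by_contra hij
    refine hblock.not_reachable_sdiff (hxsupp i) (hxsupp j) (fun h => hij (hxinj i j hi hj h)) ?_
    exact hiz.trans ((reachable_of_mem_edge
      (by rw [SimpleGraph.edgeSet_sdiff]; exact ⟨hgH, hgB⟩) hz hz').trans hjz.symm)
  have hleft : D.left ≤ u := by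
    intro g
    rw [D.left_eq, Finsupp.add_apply, Finsupp.finsetSum_apply, Finsupp.finsetSum_apply]
    change ∑ i ∈ Finset.range n, (Finsupp.single (e i) 1) g +
      ∑ i ∈ Finset.range n, P (x i) g ≤ u g
    by_cases hg : (g : Sym2 V) ∈ B.edgeSet
    · rw [Finset.sum_eq_zero (s := Finset.range n) (f := fun i => P (x i) g) fun i _ => by
        by_contra hc
        exact ((hMP (x i) (hxe i)).2.2.2.1 g (Finsupp.mem_support_iff.mpr hc)).1 hg, add_zero]
      have hug := Finsupp.mem_support_iff.mp (hB g hg)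
      refine sum_range_nat_le_of_unique (fun i _ => ?_) fun i hi j hj hi0 hj0 => ?_
      · rw [Finsupp.single_apply]
        split_ifs <;> omega
      · simp only [Finsupp.single_apply, ne_eq, ite_eq_right_iff, one_ne_zero, imp_false,
          not_not] at hi0 hj0
        exact heinj i j (by simpa using hi) (by simpa using hj) (hi0.trans hj0.symm)
    · rw [Finset.sum_eq_zero (s := Finset.range n) (f := fun i => Finsupp.single (e i) 1 g)
        fun i _ => by
          refine Finsupp.single_eq_of_ne ?_
          rintro rfl
          exact hg (heB i), zero_add]
      refine sum_range_nat_le_of_unique (fun i _ => (hMP (x i) (hxe i)).2.1 g)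
        fun i hi j hj hi0 hj0 => ?_
      have h1 := Finsupp.mem_support_iff.mpr hi0
      have hgu := Finsupp.support_mono (hMP (x i) (hxe i)).2.1 h1
      exact huniq g (hu g hgu) hg i (by simpa using hi) j (by simpa using hj)
        ((hMP (x i) (hxe i)).2.2.2.1 g h1).2
        ((hMP (x j) (hxe j)).2.2.2.1 g (Finsupp.mem_support_iff.mpr hj0)).2
  have hright : D.right ≤ v := by
    intro g
    rw [D.right_eq, Finsupp.finsetSum_apply]
    refine sum_range_nat_le_of_unique (fun i _ => (hMP (x i) (hxe i)).1 g)
      fun i hi j hj hi0 hj0 => ?_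
    have h1 := Finsupp.mem_support_iff.mpr hi0
    have hgv := Finsupp.support_mono (hMP (x i) (hxe i)).1 h1
    exact huniq g (hv' g hgv).1 (hv' g hgv).2 i (by simpa using hi) j (by simpa using hj)
      ((hMP (x i) (hxe i)).2.2.1 g h1)
      ((hMP (x j) (hxe j)).2.2.1 g (Finsupp.mem_support_iff.mpr hj0))
  have hne : D.left ≠ D.right := by
    intro h
    have h1 : D.right (e 0) = 0 := by
      have h2 := hright (e 0)
      have h3 := Finsupp.notMem_support_iff.mp (hprim.disjoint huv (hB (e 0) (heB 0)))
      omega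
    rw [← h, D.left_eq, Finsupp.add_apply, Finsupp.finsetSum_apply, Nat.add_eq_zero_iff,
      Finset.sum_eq_zero_iff] at h1
    have h4 : Finsupp.single (e 0) 1 (e 0) = 0 :=
      h1.1 0 (Finset.mem_range.mpr (show 0 < n by omega))
    simp at h4
  exact ⟨D, hprim.2 _ _ D.vertexDeg_left hne hleft hright⟩

end

/-! ### The monomials of a walk -/

namespace EvenClosedWalk

variable {G : SimpleGraph V} (w : EvenClosedWalk G)

lemma mem_support_plusExp {e : G.edgeSet} : e ∈ w.plusExp.support ↔ (e : Sym2 V) ∈ w.plusEdges := by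
  classical
  rw [Finsupp.mem_support_iff, plusExp, Finsupp.finsetSum_apply, Ne, Finset.sum_eq_zero_iff]
  simp only [Finset.mem_univ, true_imp_iff, not_forall, Finsupp.single_apply,
    ite_eq_right_iff, one_ne_zero, imp_false, not_not]
  constructor
  · rintro ⟨k, rfl⟩
    exact ⟨k, k.isLt, rfl⟩
  · rintro ⟨k, hk, h⟩
    exact ⟨⟨k, hk⟩, Subtype.ext h.symm⟩

lemma mem_support_minusExp {e : G.edgeSet} :
    e ∈ w.minusExp.support ↔ (e : Sym2 V) ∈ w.minusEdges := by
  classical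
  rw [Finsupp.mem_support_iff, minusExp, Finsupp.finsetSum_apply, Ne, Finset.sum_eq_zero_iff]
  simp only [Finset.mem_univ, true_imp_iff, not_forall, Finsupp.single_apply,
    ite_eq_right_iff, one_ne_zero, imp_false, not_not]
  constructor
  · rintro ⟨k, rfl⟩
    exact ⟨k, k.isLt, rfl⟩
  · rintro ⟨k, hk, h⟩
    exact ⟨⟨k, hk⟩, Subtype.ext h.symm⟩

lemma mem_edgeSet_graph {i : ℕ} (hi : i < 2 * w.q) :
    s(w.verts i, w.verts (i + 1)) ∈ w.graph.edgeSet := by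
  rw [graph, SimpleGraph.edgeSet_fromEdgeSet]
  exact ⟨⟨i, hi, rfl⟩, G.not_isDiag_of_mem_edgeSet (w.adj i hi)⟩

lemma plusEdges_subset : w.plusEdges ⊆ w.graph.edgeSet := by
  rintro _ ⟨k, hk, rfl⟩
  exact w.mem_edgeSet_graph (by omega)

lemma minusEdges_subset : w.minusEdges ⊆ w.graph.edgeSet := by
  rintro _ ⟨k, hk, rfl⟩
  exact w.mem_edgeSet_graph (i := 2 * k + 1) (by omega)

lemma graph_le : w.graph ≤ G := by
  intro a b hab
  rw [graph, SimpleGraph.fromEdgeSet_adj] at hab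
  obtain ⟨⟨i, hi, h⟩, -⟩ := hab
  rw [← SimpleGraph.mem_edgeSet, h]
  exact w.adj i hi

end EvenClosedWalk

/-- If the cycle `B` is a block of a graph containing all edges of `u` and `v`, and all edges of
`B` divide `u`, then `u` and `v` are not the exponents of a reduced Gröbner basis element. -/
lemma false_of_pure_cycle {G H B : SimpleGraph V} (hBG : B ≤ G) (hblock : IsBlock H B)
    (hcyc : IsCycleGraph B) {u v : G.edgeSet →₀ ℕ} (huv : vertexDeg G u = vertexDeg G v)
    (hu : ∀ e ∈ u.support, (e : Sym2 V) ∈ H.edgeSet)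
    (hv : ∀ e ∈ v.support, (e : Sym2 V) ∈ H.edgeSet)
    (hB : ∀ e : G.edgeSet, (e : Sym2 V) ∈ B.edgeSet → e ∈ u.support) (t : TermOrder G.edgeSet)
    (ht : t.IsReducedPair (fun a b => vertexDeg G a = vertexDeg G b) u v ∨
      t.IsReducedPair (fun a b => vertexDeg G a = vertexDeg G b) v u) : False := by
  have hprim : IsPrimitivePair (fun a b => vertexDeg G a = vertexDeg G b) u v := by
    rcases ht with ht | ht
    · exact ht.isPrimitivePair huv
    · exact (ht.isPrimitivePair huv.symm).symm
  obtain ⟨D, rfl, rfl⟩ := exists_cycleDecomposition hBG hblock hcyc huv hprim hu hv hB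
  rcases ht with ht | ht
  · exact D.not_isReducedPair_left t ht
  · exact D.not_isReducedPair_right t ht

/-- If a primitive even closed walk `w` has a pure cyclic block, then `B_w`
does not belong to the universal Gröbner basis of `I_G`. -/
theorem Bw_not_mem_universalGB_of_pureCyclicBlock {V : Type*} [Fintype V]
    (G : SimpleGraph V) (hG : G.Connected) (K : Type*) [Field K]
    (w : EvenClosedWalk G) (hw : w.IsPrimitive)
    (hpure : ∃ B : SimpleGraph V, IsPureCyclicBlock w B) :
    Bw K w ∉ UniversalGB (graphToricIdeal K G) := by
  rintro hmem
  obtain ⟨B, hblock, hcyc, hpure⟩ := hpure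
  obtain ⟨hI, t, ht⟩ := isReducedPair_of_mem_universalGB hmem
  simp only [binom_mem_graphToricIdeal_iff] at hI ht
  have hBG : B ≤ G := hblock.1.trans w.graph_le
  have hplus : ∀ e ∈ w.plusExp.support, (e : Sym2 V) ∈ w.graph.edgeSet :=
    fun e he => w.plusEdges_subset (w.mem_support_plusExp.mp he)
  have hminus : ∀ e ∈ w.minusExp.support, (e : Sym2 V) ∈ w.graph.edgeSet :=
    fun e he => w.minusEdges_subset (w.mem_support_minusExp.mp he)
  rcases hpure with hpure | hpure
  · exact false_of_pure_cycle hBG hblock hcyc hI hplus hminus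
      (fun e he => w.mem_support_plusExp.mpr (hpure he)) t ht
  · exact false_of_pure_cycle hBG hblock hcyc hI.symm hminus hplus
      (fun e he => w.mem_support_minusExp.mpr (hpure he)) t ht.symm

end
end

section
/- For every n ≥ 4, the largest total degree of a binomial in the universal Gröbner basis of I_{K_n} equals n − 2. -/
open MvPolynomial

noncomputable section

variable {σ : Type*} {K : Type*} [Field K]

/-! ### Toric ideals of graphs -/

variable {V : Type*}

/-! ### Reduced Gröbner bases of toric ideals -/

namespace TermOrder

theorem leadExp_mem_support (t : TermOrder σ) {f : MvPolynomial σ K} (hf : f ≠ 0) :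
    t.leadExp f ∈ f.support := by
  let _ := t.lo
  rw [leadExp, dif_neg hf]
  exact Finset.max'_mem _ _

theorem le_leadExp (t : TermOrder σ) {f : MvPolynomial σ K} {u : σ →₀ ℕ} (hu : u ∈ f.support) :
    t.lo.le u (t.leadExp f) := by
  let _ := t.lo
  have hf : f ≠ 0 := by rintro rfl; simp at hu
  rw [leadExp, dif_neg hf]
  exact Finset.le_max' _ _ hu

theorem le_of_le (t : TermOrder σ) {u v : σ →₀ ℕ} (h : u ≤ v) : t.lo.le u v := by
  have := t.add_right 0 (v - u) u (t.zero_min _)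
  rwa [zero_add, tsub_add_cancel_of_le h] at this

theorem eq_of_le_of_le (t : TermOrder σ) {u v : σ →₀ ℕ} (h : t.lo.le u v) (h' : t.lo.le v u) :
    u = v := t.lo.le_antisymm _ _ h h'

theorem initial_eq_zero_iff (t : TermOrder σ) {f : MvPolynomial σ K} :
    t.initial f = 0 ↔ f = 0 := by
  rw [initial, monomial_eq_zero]
  refine ⟨fun h => ?_, by rintro rfl; simp⟩
  by_contra hf
  exact mem_support_iff.mp (t.leadExp_mem_support hf) h

end TermOrder

theorem mem_support_binom {u v w : σ →₀ ℕ} (h : u ≠ v) :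
    w ∈ (binom K u v).support ↔ w = u ∨ w = v := by
  classical
  rw [mem_support_iff, binom, coeff_sub, coeff_monomial, coeff_monomial]
  by_cases h1 : u = w <;> by_cases h2 : v = w <;> simp_all [eq_comm]

theorem binom_ne_zero {u v : σ →₀ ℕ} (h : u ≠ v) : binom K u v ≠ 0 := by
  intro h0
  have := (mem_support_binom (K := K) h).mpr (Or.inl rfl)
  simp [h0] at this

theorem leadExp_binom (t : TermOrder σ) {u v : σ →₀ ℕ} (h : u ≠ v) (hle : t.lo.le v u) :
    t.leadExp (binom K u v) = u := by
  have h1 := (mem_support_binom h).mp (t.leadExp_mem_support (binom_ne_zero (K := K) h))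
  have h2 := t.le_leadExp ((mem_support_binom (K := K) h).mpr (Or.inl rfl))
  rcases h1 with h1 | h1
  · exact h1
  · rw [h1] at h2 ⊢
    exact t.eq_of_le_of_le hle h2

theorem coeff_binom_left {u v : σ →₀ ℕ} (h : u ≠ v) : (binom K u v).coeff u = 1 := by
  classical
  simp [binom, coeff_sub, coeff_monomial, h.symm]

section Toric

variable {M : Type*} [AddCommMonoid M]

/-- The lattice data of a toric ideal `I` graded by `A`: it contains all binomials homogeneous with
respect to `A`, and no monomial is isolated in its fibre in an element of `I`. -/
structure IsToric (A : (σ →₀ ℕ) →+ M) (I : Ideal (MvPolynomial σ K)) : Prop where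
  binom_mem : ∀ u v, A u = A v → binom K u v ∈ I
  exists_fiber : ∀ f ∈ I, ∀ u ∈ f.support, ∃ v ∈ f.support, v ≠ u ∧ A v = A u

/-- The pair of exponents of a primitive `A`-homogeneous binomial. -/
structure IsPrimitivePair_s10 (A : (σ →₀ ℕ) →+ M) (u v : σ →₀ ℕ) : Prop where
  ne : u ≠ v
  map_eq : A u = A v
  eq_of_le : ∀ w z, w ≠ z → A w = A z → w ≤ u → z ≤ v → w = u ∧ z = v

namespace IsReducedGroebnerBasis

variable {t : TermOrder σ} {I : Ideal (MvPolynomial σ K)} {𝒢 : Finset (MvPolynomial σ K)}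

theorem ne_zero (h : IsReducedGroebnerBasis t I 𝒢) {g : MvPolynomial σ K} (hg : g ∈ 𝒢) :
    g ≠ 0 := by
  rintro rfl
  simpa using h.2.1 _ hg

theorem exists_leadExp_le_s10 (h : IsReducedGroebnerBasis t I 𝒢) {f : MvPolynomial σ K} (hf : f ∈ I)
    (hf0 : f ≠ 0) : ∃ g ∈ 𝒢, t.leadExp g ≤ t.leadExp f := by
  have h1 : t.initial f ∈ Ideal.span (t.initial '' (I : Set (MvPolynomial σ K))) :=
    Ideal.subset_span ⟨f, hf, rfl⟩
  rw [← h.1.2] at h1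
  have h2 : t.initial '' (𝒢 : Set (MvPolynomial σ K)) =
      (fun s => monomial s (1 : K)) '' (t.leadExp '' (𝒢 : Set (MvPolynomial σ K))) := by
    rw [Set.image_image]
    refine Set.image_congr fun g hg => ?_
    rw [TermOrder.initial, h.2.1 g hg]
  classical
  rw [h2, mem_ideal_span_monomial_image] at h1
  obtain ⟨s, ⟨g, hg, rfl⟩, hle⟩ := h1 (t.leadExp f) (by
    rw [TermOrder.initial, mem_support_iff, coeff_monomial, if_pos rfl]
    exact mem_support_iff.mp (t.leadExp_mem_support hf0))
  exact ⟨g, hg, hle⟩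

theorem not_leadExp_le (h : IsReducedGroebnerBasis t I 𝒢) {g : MvPolynomial σ K} (hg : g ∈ 𝒢)
    {u : σ →₀ ℕ} (hu : u ∈ g.support) (hne : u ≠ t.leadExp g) {f : MvPolynomial σ K} (hf : f ∈ I)
    (hf0 : f ≠ 0) : ¬ t.leadExp f ≤ u := by
  intro hle
  obtain ⟨g', hg', hle'⟩ := h.exists_leadExp_le_s10 hf hf0
  by_cases hgg : g' = g
  · subst hgg
    exact hne (t.eq_of_le_of_le (t.le_leadExp hu) (t.le_of_le (hle'.trans hle)))
  · exact h.2.2 g hg g' hg' hgg u hu (hle'.trans hle)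

theorem exists_isPrimitivePair (h : IsReducedGroebnerBasis t I 𝒢) {A : (σ →₀ ℕ) →+ M}
    (hI : IsToric A I) (hA : ∀ u v, A u = A v → u.degree = v.degree) {g : MvPolynomial σ K}
    (hg : g ∈ 𝒢) : ∃ v, g = binom K (t.leadExp g) v ∧ IsPrimitivePair_s10 A (t.leadExp g) v := by
  classical
  have hgI : g ∈ I := h.1.1 hg
  have hu := t.leadExp_mem_support (h.ne_zero hg)
  set u := t.leadExp g with hu_def
  obtain ⟨v, hv, hvu, hAv⟩ := hI.exists_fiber g hgI u hu
  have hvlt : t.lo.le v u := t.le_leadExp hv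
  have hb : t.leadExp (binom K u v) = u := leadExp_binom t hvu.symm hvlt
  have hgb : g = binom K u v := by
    by_contra hne
    have hne0 : g - binom K u v ≠ 0 := sub_ne_zero.mpr hne
    have hmem : g - binom K u v ∈ I := I.sub_mem hgI (hI.binom_mem _ _ hAv.symm)
    have h1 := t.leadExp_mem_support hne0
    have h2 : t.leadExp (g - binom K u v) ≠ u := by
      intro h2
      rw [h2, mem_support_iff, coeff_sub, h.2.1 g hg, coeff_binom_left hvu.symm] at h1
      simp at h1
    have h3 : t.leadExp (g - binom K u v) ∈ g.support := by
      have := support_sub σ g (binom K u v) h1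
      rw [Finset.mem_union, mem_support_binom hvu.symm] at this
      rcases this with h' | h' | h'
      · exact h'
      · exact absurd h' h2
      · rw [h']; exact hv
    exact h.not_leadExp_le hg h3 h2 hmem hne0 le_rfl
  refine ⟨v, hgb, hvu.symm, hAv.symm, fun w z hwz hAwz hwu hzv => ?_⟩
  have hw : w = u := by
    by_contra hwne
    rcases t.lo.le_total w z with hle | hle
    · have := h.not_leadExp_le hg hv hvu (hI.binom_mem z w hAwz.symm) (binom_ne_zero hwz.symm)
      rw [leadExp_binom t hwz.symm hle] at this
      exact this hzv
    · obtain ⟨g', hg', hle'⟩ :=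
        h.exists_leadExp_le_s10 (hI.binom_mem w z hAwz) (binom_ne_zero (K := K) hwz)
      rw [leadExp_binom t hwz hle] at hle'
      by_cases hgg : g' = g
      · subst hgg
        exact hwne (le_antisymm hwu hle')
      · exact h.2.2 g hg g' hg' hgg u hu (hle'.trans hwu)
  refine ⟨hw, ?_⟩
  subst hw
  have hd := hA _ _ (hAv.trans hAwz)
  rw [← tsub_add_cancel_of_le hzv, map_add, add_eq_right, Finsupp.degree_eq_zero_iff] at hd
  rw [← tsub_add_cancel_of_le hzv, hd, zero_add]

end IsReducedGroebnerBasis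

theorem totalDegree_binom {u v : σ →₀ ℕ} (h : u ≠ v) (hd : u.degree = v.degree) :
    (binom K u v).totalDegree = u.degree := by
  refine le_antisymm (Finset.sup_le fun w hw => ?_)
    (le_totalDegree ((mem_support_binom h).mpr (Or.inl rfl)))
  rcases (mem_support_binom h).mp hw with rfl | rfl
  · exact le_rfl
  · exact hd.ge

theorem IsToric.exists_isReducedGroebnerBasis [Finite σ] {A : (σ →₀ ℕ) →+ M}
    {I : Ideal (MvPolynomial σ K)} (hI : IsToric A I)
    (hA : ∀ u v, A u = A v → u.degree = v.degree) (t : TermOrder σ) :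
    ∃ 𝒢 : Finset (MvPolynomial σ K), IsReducedGroebnerBasis t I 𝒢 := by
  classical
  have hmin : ∀ u : σ →₀ ℕ, ∃ v, A v = A u ∧ ∀ w, A w = A u → t.lo.le v w := by
    intro u
    have hfin : {w | A w = A u}.Finite :=
      (Finsupp.finite_of_degree_eq u.degree).subset fun w hw => hA _ _ hw
    obtain ⟨v, hv, hle⟩ := @Set.exists_min_image _ _ t.lo _ id hfin ⟨u, rfl⟩
    exact ⟨v, hv, hle⟩
  choose m hm hmle using hmin
  let L : Set (σ →₀ ℕ) := {u | m u ≠ u}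
  have hlead : ∀ f ∈ I, f ≠ 0 → t.leadExp f ∈ L := by
    intro f hf hf0 heq
    obtain ⟨v, hv, hvu, hAv⟩ := hI.exists_fiber f hf _ (t.leadExp_mem_support hf0)
    have h1 := hmle _ v hAv
    rw [heq] at h1
    exact hvu (t.eq_of_le_of_le (t.le_leadExp hv) h1)
  have hm_std : ∀ u, ∀ w ∈ L, ¬ w ≤ m u := by
    intro u w hw hle
    have h1 : A (m w + (m u - w)) = A u := by
      rw [map_add, hm w, ← map_add, add_tsub_cancel_of_le hle, hm]
    have h2 := hmle u _ h1
    have h3 := t.add_right _ _ (m u - w) (hmle w w rfl)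
    rw [add_tsub_cancel_of_le hle] at h3
    have h4 := t.eq_of_le_of_le h3 h2
    exact hw (add_right_cancel (b := m u - w) (by rw [h4, add_tsub_cancel_of_le hle]))
  let N : Set (σ →₀ ℕ) := {u | Minimal (· ∈ L) u}
  have hNfin : N.Finite := WellQuasiOrderedLE.finite_of_isAntichain (setOfPred_minimal_antichain _)
  let G : (σ →₀ ℕ) → MvPolynomial σ K := fun u => binom K u (m u)
  have hGlead : ∀ u ∈ L, t.leadExp (G u) = u := fun u hu =>
    leadExp_binom t (Ne.symm hu) (hmle u u rfl)
  have hGinit : ∀ u ∈ L, t.initial (G u) = monomial u 1 := by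
    intro u hu
    rw [TermOrder.initial, hGlead u hu, coeff_binom_left (Ne.symm hu)]
  have hGI : ∀ u, G u ∈ I := fun u => hI.binom_mem _ _ (hm u).symm
  refine ⟨hNfin.toFinset.image G, ⟨?_, ?_⟩, ?_, ?_⟩
  · intro f hf
    simp only [Finset.coe_image, Set.Finite.coe_toFinset] at hf
    obtain ⟨u, -, rfl⟩ := hf
    exact hGI u
  · apply le_antisymm
    · apply Ideal.span_mono
      apply Set.image_mono
      intro f hf
      simp only [Finset.coe_image, Set.Finite.coe_toFinset] at hf
      obtain ⟨u, -, rfl⟩ := hf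
      exact hGI u
    · rw [Ideal.span_le]
      rintro _ ⟨f, hf, rfl⟩
      by_cases hf0 : f = 0
      · rw [t.initial_eq_zero_iff.mpr hf0]
        exact zero_mem _
      obtain ⟨w, hw, hwmin⟩ := exists_minimal_le_of_wellFoundedLT (· ∈ L) _ (hlead f hf hf0)
      have h1 : t.initial f = monomial (t.leadExp f - w) (f.coeff (t.leadExp f)) *
          t.initial (G w) := by
        rw [hGinit w hwmin.1, monomial_mul, tsub_add_cancel_of_le hw, mul_one, TermOrder.initial]
      rw [h1]
      apply Ideal.mul_mem_left
      apply Ideal.subset_span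
      refine ⟨G w, ?_, rfl⟩
      simp only [Finset.coe_image, Set.Finite.coe_toFinset]
      exact ⟨w, hwmin, rfl⟩
  · intro g hg
    simp only [Finset.mem_image, Set.Finite.mem_toFinset] at hg
    obtain ⟨u, hu, rfl⟩ := hg
    rw [hGlead u hu.1, coeff_binom_left (Ne.symm hu.1)]
  · intro g hg g' hg' hne w hw
    simp only [Finset.mem_image, Set.Finite.mem_toFinset] at hg hg'
    obtain ⟨u, hu, rfl⟩ := hg
    obtain ⟨u', hu', rfl⟩ := hg'
    rw [hGlead u' hu'.1]
    rcases (mem_support_binom (Ne.symm hu.1)).mp hw with rfl | rfl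
    · intro hle
      exact hne (by rw [le_antisymm hle (hu.2 hu'.1 hle)])
    · exact hm_std u u' hu'.1

/-! ### Elimination term orders -/

/-- The term order comparing first the degree in the variables outside `S`, and then
lexicographically. -/
def elimOrder [LinearOrder σ] (S : Set σ) : TermOrder σ :=
  letI wt : (σ →₀ ℕ) →+ ℕ := Finsupp.weight (Sᶜ.indicator fun _ => 1)
  { lo := LinearOrder.lift' (fun u => toLex (wt u, toLex u)) fun u v h => by
      simpa using congrArg (fun p => ofLex (ofLex p).2) h
    zero_min := fun u => by
      change toLex (wt 0, toLex 0) ≤ toLex (wt u, toLex u)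
      rw [Prod.Lex.toLex_le_toLex]
      rcases Nat.eq_zero_or_pos (wt u) with h | h
      · exact Or.inr ⟨by simp [h], bot_le (α := Lex (σ →₀ ℕ))⟩
      · exact Or.inl (by simpa using h)
    add_right := fun u v w h => by
      change toLex (wt u, toLex u) ≤ toLex (wt v, toLex v) at h
      change toLex (wt (u + w), toLex (u + w)) ≤ toLex (wt (v + w), toLex (v + w))
      rw [Prod.Lex.toLex_le_toLex] at h ⊢
      simp only [map_add] at h ⊢
      rcases h with h | ⟨h, h'⟩
      · exact Or.inl (by omega)
      · refine Or.inr ⟨by omega, ?_⟩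
        rw [toLex_add, toLex_add]
        exact add_le_add_left h' _ }

theorem elimOrder_support [LinearOrder σ] {S : Set σ} {u v : σ →₀ ℕ} (h : (elimOrder S).lo.le u v)
    (hv : ∀ e ∉ S, v e = 0) : ∀ e ∉ S, u e = 0 := by
  set wt : (σ →₀ ℕ) →+ ℕ := Finsupp.weight (Sᶜ.indicator fun _ => 1) with hwt
  change toLex (wt u, toLex u) ≤ toLex (wt v, toLex v) at h
  have h1 : wt u ≤ wt v := by
    rw [Prod.Lex.toLex_le_toLex] at h
    rcases h with h | h
    · exact h.le
    · exact h.1.le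
  have h2 : wt v = 0 := by
    rw [hwt, Finsupp.weight_apply, Finsupp.sum]
    refine Finset.sum_eq_zero fun e _ => ?_
    by_cases he : e ∈ S <;> simp [he, hv]
  intro e he
  have h3 := Finsupp.le_weight (Sᶜ.indicator fun _ => 1) (s := e) (by simp [he]) u
  change u e ≤ wt u at h3
  omega

/-- Elimination: some element of the universal Gröbner basis only involves variables of `S`, as
soon as the ideal contains a binomial in these variables. -/
theorem IsToric.exists_mem_universalGB [Finite σ] {A : (σ →₀ ℕ) →+ M}
    {I : Ideal (MvPolynomial σ K)} (hI : IsToric A I)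
    (hA : ∀ u v, A u = A v → u.degree = v.degree) {S : Set σ} {u v : σ →₀ ℕ} (huv : u ≠ v)
    (hAuv : A u = A v) (hu : ∀ e ∉ S, u e = 0) (hv : ∀ e ∉ S, v e = 0) :
    ∃ w z, binom K w z ∈ UniversalGB I ∧ IsPrimitivePair_s10 A w z ∧ (∀ e ∉ S, w e = 0) ∧
      ∀ e ∉ S, z e = 0 := by
  classical
  let _ : LinearOrder σ := linearOrderOfSTO WellOrderingRel
  obtain ⟨𝒢, h𝒢⟩ := hI.exists_isReducedGroebnerBasis hA (elimOrder S)
  wlog hle : (elimOrder S).lo.le v u generalizing u v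
  · exact this huv.symm hAuv.symm hv hu (((elimOrder S).lo.le_total _ _).resolve_left hle)
  obtain ⟨g, hg, hgle⟩ := h𝒢.exists_leadExp_le_s10 (hI.binom_mem _ _ hAuv) (binom_ne_zero huv)
  rw [leadExp_binom _ huv hle] at hgle
  obtain ⟨z, hgz, hprim⟩ := h𝒢.exists_isPrimitivePair hI hA hg
  have hw : ∀ e ∉ S, (elimOrder S).leadExp g e = 0 := fun e he =>
    Nat.le_zero.mp ((hgle e).trans (hu e he).le)
  refine ⟨_, z, hgz ▸ ⟨_, 𝒢, h𝒢, hg⟩, hprim, hw, elimOrder_support ?_ hw⟩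
  apply TermOrder.le_leadExp
  have := (mem_support_binom (K := K) hprim.ne).mpr (Or.inr rfl)
  rwa [← hgz] at this


end Toric

/-! ### The vertex grading of the toric ideal of a graph -/

/-- The exponent vector of `edgeImage`: the incidence vector of an edge. -/
def incidenceVec (e : Sym2 V) : V →₀ ℕ :=
  Sym2.lift ⟨fun a b => Finsupp.single a 1 + Finsupp.single b 1, fun _ _ => add_comm _ _⟩ e

theorem incidenceVec_mk (a b : V) :
    incidenceVec s(a, b) = Finsupp.single a 1 + Finsupp.single b 1 := rfl

theorem incidenceVec_apply_of_notMem {e : Sym2 V} {x : V} (h : x ∉ e) : incidenceVec e x = 0 := by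
  classical
  induction e with
  | h a b =>
    rw [Sym2.mem_iff, not_or] at h
    simp [incidenceVec_mk, Ne.symm h.1, Ne.symm h.2]

theorem degree_incidenceVec (e : Sym2 V) : (incidenceVec e).degree = 2 := by
  induction e with
  | h a b => simp [incidenceVec_mk, map_add]

theorem edgeImage_eq_monomial (e : Sym2 V) : edgeImage K e = monomial (incidenceVec e) 1 := by
  induction e with
  | h a b =>
    change X a * X b = _
    rw [incidenceVec_mk, X, X, monomial_mul, one_mul]

/-- The vector of vertex degrees of a multiset of edges of `G`. -/
def vertexDegree (G : SimpleGraph V) : (G.edgeSet →₀ ℕ) →+ (V →₀ ℕ) :=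
  (Finsupp.linearCombination ℕ fun e : G.edgeSet => incidenceVec (e : Sym2 V)).toAddMonoidHom

theorem vertexDegree_eq_sum (G : SimpleGraph V) (u : G.edgeSet →₀ ℕ) :
    vertexDegree G u = u.sum fun e k => k • incidenceVec (e : Sym2 V) := rfl

theorem vertexDegree_apply (G : SimpleGraph V) (u : G.edgeSet →₀ ℕ) (x : V) :
    vertexDegree G u x = u.sum fun e k => k * incidenceVec (e : Sym2 V) x := by
  simp [vertexDegree_eq_sum, Finsupp.sum]

@[simp]
theorem vertexDegree_single (G : SimpleGraph V) (e : G.edgeSet) (k : ℕ) :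
    vertexDegree G (Finsupp.single e k) = k • incidenceVec (e : Sym2 V) := by
  simp [vertexDegree_eq_sum]

theorem degree_vertexDegree (G : SimpleGraph V) (u : G.edgeSet →₀ ℕ) :
    (vertexDegree G u).degree = 2 * u.degree := by
  rw [vertexDegree_eq_sum, Finsupp.sum, map_sum, Finsupp.degree_apply, Finset.mul_sum]
  refine Finset.sum_congr rfl fun e _ => ?_
  rw [map_nsmul, degree_incidenceVec, smul_eq_mul, mul_comm]

theorem degree_eq_of_vertexDegree_eq (G : SimpleGraph V) {u v : G.edgeSet →₀ ℕ}
    (h : vertexDegree G u = vertexDegree G v) : u.degree = v.degree := by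
  have := congrArg Finsupp.degree h
  rw [degree_vertexDegree, degree_vertexDegree] at this
  omega

theorem aeval_edgeImage_monomial (G : SimpleGraph V) (u : G.edgeSet →₀ ℕ) (c : K) :
    aeval (fun e : G.edgeSet => edgeImage K (e : Sym2 V)) (monomial u c) =
      monomial (vertexDegree G u) c := by
  rw [aeval_monomial, vertexDegree_eq_sum, Finsupp.prod, Finsupp.sum, algebraMap_eq]
  simp only [edgeImage_eq_monomial, monomial_pow, one_pow]
  rw [← monomial_sum_one, C_mul_monomial, mul_one]

theorem isToric_graphToricIdeal (G : SimpleGraph V) :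
    IsToric (vertexDegree G) (graphToricIdeal K G) where
  binom_mem u v h := by
    change aeval (fun e : G.edgeSet => edgeImage K (e : Sym2 V)) (binom K u v) = 0
    rw [binom, map_sub, aeval_edgeImage_monomial, aeval_edgeImage_monomial, h, sub_self]
  exists_fiber f hf u hu := by
    classical
    by_contra! hne
    have h0 : aeval (fun e : G.edgeSet => edgeImage K (e : Sym2 V)) f = 0 := hf
    rw [f.as_sum, map_sum] at h0
    have h1 := congrArg (coeff (vertexDegree G u)) h0
    simp only [aeval_edgeImage_monomial, coeff_sum, coeff_monomial, coeff_zero] at h1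
    rw [Finset.sum_eq_single_of_mem u hu fun v hv hvu => if_neg (hne v hv hvu), if_pos rfl] at h1
    exact mem_support_iff.mp hu h1

theorem exists_lt_of_vertexDegree_lt {G : SimpleGraph V} {u v : G.edgeSet →₀ ℕ} {x : V}
    (hlt : vertexDegree G u x < vertexDegree G v x) :
    ∃ e : G.edgeSet, x ∈ (e : Sym2 V) ∧ u e < v e := by
  classical
  by_contra! hle
  refine hlt.not_ge ?_
  rw [vertexDegree_apply, vertexDegree_apply,
    Finsupp.sum_of_support_subset u (Finset.subset_union_left (s₂ := v.support)) _ (by simp),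
    Finsupp.sum_of_support_subset v (Finset.subset_union_right (s₁ := u.support)) _ (by simp)]
  refine Finset.sum_le_sum fun e _ => ?_
  by_cases hx : x ∈ (e : Sym2 V)
  · exact Nat.mul_le_mul_right _ (hle e hx)
  · simp [incidenceVec_apply_of_notMem hx]

/-! ### Alternating trails -/

/-- The edges in the even positions `i ∈ S` of a sequence of edges. -/
def evenPart {E : Type*} (e : ℕ → E) (S : Finset ℕ) : E →₀ ℕ :=
  ∑ i ∈ S with Even i, Finsupp.single (e i) 1

/-- The edges in the odd positions `i ∈ S` of a sequence of edges. -/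
def oddPart {E : Type*} (e : ℕ → E) (S : Finset ℕ) : E →₀ ℕ :=
  ∑ i ∈ S with ¬ Even i, Finsupp.single (e i) 1

section Parts

variable {E : Type*} (e : ℕ → E)

theorem evenPart_mono {S T : Finset ℕ} (h : S ⊆ T) : evenPart e S ≤ evenPart e T :=
  Finset.sum_le_sum_of_subset (Finset.filter_subset_filter _ h)

theorem oddPart_mono {S T : Finset ℕ} (h : S ⊆ T) : oddPart e S ≤ oddPart e T :=
  Finset.sum_le_sum_of_subset (Finset.filter_subset_filter _ h)

theorem degree_evenPart_add_degree_oddPart (S : Finset ℕ) :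
    (evenPart e S).degree + (oddPart e S).degree = S.card := by
  simp only [evenPart, oddPart, map_sum, Finsupp.degree_single, Finset.sum_const, smul_eq_mul,
    mul_one]
  exact Finset.card_filter_add_card_filter_not _

theorem evenPart_range_succ (k : ℕ) : evenPart e (Finset.range (k + 1)) =
    evenPart e (Finset.range k) + if Even k then Finsupp.single (e k) 1 else 0 := by
  simp only [evenPart, Finset.sum_filter, Finset.sum_range_succ]

theorem oddPart_range_succ (k : ℕ) : oddPart e (Finset.range (k + 1)) =
    oddPart e (Finset.range k) + if ¬ Even k then Finsupp.single (e k) 1 else 0 := by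
  simp only [oddPart, Finset.sum_filter, Finset.sum_range_succ]

variable {e}

theorem evenPart_congr {f : ℕ → E} {S : Finset ℕ} (h : ∀ i ∈ S, e i = f i) :
    evenPart e S = evenPart f S :=
  Finset.sum_congr rfl fun i hi => by rw [h i (Finset.mem_filter.mp hi).1]

theorem oddPart_congr {f : ℕ → E} {S : Finset ℕ} (h : ∀ i ∈ S, e i = f i) :
    oddPart e S = oddPart f S :=
  Finset.sum_congr rfl fun i hi => by rw [h i (Finset.mem_filter.mp hi).1]

end Parts

/-- The sum over `i ∈ S` of the incidence vectors of the edges `e i`, with alternating signs. -/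
theorem vertexDegree_evenPart_sub_oddPart {G : SimpleGraph V} (e : ℕ → G.edgeSet) (S : Finset ℕ)
    (y : V) : (vertexDegree G (evenPart e S) y : ℤ) - vertexDegree G (oddPart e S) y =
      ∑ i ∈ S, (-1) ^ i * (incidenceVec (e i : Sym2 V) y : ℤ) := by
  simp only [evenPart, oddPart, map_sum, vertexDegree_single, one_smul, Finsupp.finsetSum_apply,
    Nat.cast_sum]
  rw [← Finset.sum_filter_add_sum_filter_not S (fun i => Even i), sub_eq_add_neg,
    ← Finset.sum_neg_distrib]
  congr 1
  · refine Finset.sum_congr rfl fun i hi => ?_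
    rw [(Finset.mem_filter.mp hi).2.neg_one_pow, one_mul]
  · refine Finset.sum_congr rfl fun i hi => ?_
    rw [(Nat.not_even_iff_odd.mp (Finset.mem_filter.mp hi).2).neg_one_pow, neg_one_mul]

open Classical in
/-- The signed indicator of the `i`-th vertex of a walk. -/
def signedVertex (x : ℕ → V) (y : V) (i : ℕ) : ℤ := if x i = y then (-1) ^ i else 0

theorem sum_Ico_incidenceVec {G : SimpleGraph V} {e : ℕ → G.edgeSet} {x : ℕ → V} {a b : ℕ}
    (hab : a ≤ b) (h : ∀ i < b, (e i : Sym2 V) = s(x i, x (i + 1))) (y : V) :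
    ∑ i ∈ Finset.Ico a b, (-1) ^ i * (incidenceVec (e i : Sym2 V) y : ℤ) =
      signedVertex x y a - signedVertex x y b := by
  classical
  induction b, hab using Nat.le_induction with
  | base => simp
  | succ b hab ih =>
    rw [Finset.sum_Ico_succ_top hab, ih fun i hi => h i (by omega), h b (by omega),
      incidenceVec_mk, Finsupp.add_apply, Finsupp.single_apply, Finsupp.single_apply]
    simp only [signedVertex]
    split_ifs <;> push_cast <;> ring

/-- A trail `x 0, x 1, …, x k` with edges `e i`, using alternately edges of `u` and of `v`. -/
structure IsAlternatingTrail {G : SimpleGraph V} (u v : G.edgeSet →₀ ℕ) (x : ℕ → V)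
    (e : ℕ → G.edgeSet) (k : ℕ) : Prop where
  edge_eq : ∀ i < k, (e i : Sym2 V) = s(x i, x (i + 1))
  even_le : evenPart e (Finset.range k) ≤ u
  odd_le : oddPart e (Finset.range k) ≤ v

theorem add_single_le {E : Type*} {u v : E →₀ ℕ} {e : E} (h : u ≤ v) (he : u e < v e) :
    u + Finsupp.single e 1 ≤ v := by
  classical
  intro f
  rw [Finsupp.add_apply, Finsupp.single_apply]
  have := h f
  split_ifs with hf
  · subst hf; omega
  · omega

namespace IsAlternatingTrail

variable {G : SimpleGraph V} {u v : G.edgeSet →₀ ℕ} {x : ℕ → V} {e : ℕ → G.edgeSet} {k : ℕ}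

theorem extend (h : IsAlternatingTrail u v x e k) {f : G.edgeSet} (hf : x k ∈ (f : Sym2 V))
    (heven : Even k → evenPart e (Finset.range k) f < u f)
    (hodd : ¬ Even k → oddPart e (Finset.range k) f < v f) :
    ∃ x' e', x' 0 = x 0 ∧ IsAlternatingTrail u v x' e' (k + 1) := by
  obtain ⟨b, hb⟩ := Sym2.mem_iff_exists.mp hf
  have hcongr : ∀ i ∈ Finset.range k, (if i < k then e i else f) = e i := fun i hi =>
    if_pos (Finset.mem_range.mp hi)
  refine ⟨fun i => if i ≤ k then x i else b, fun i => if i < k then e i else f, by simp, ?_, ?_, ?_⟩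
  · intro i hi
    rcases Nat.lt_succ_iff_lt_or_eq.mp hi with hi | rfl
    · simp [hi, hi.le, Nat.succ_le_of_lt hi, h.edge_eq i hi]
    · simp [hb]
  · rw [evenPart_range_succ, evenPart_congr hcongr]
    simp only [lt_self_iff_false, if_false]
    split_ifs with hk
    · simpa using add_single_le h.even_le (heven hk)
    · simpa using h.even_le
  · rw [oddPart_range_succ, oddPart_congr hcongr]
    simp only [lt_self_iff_false, if_false]
    split_ifs with hk
    · simpa using h.odd_le
    · simpa using add_single_le h.odd_le (hodd hk)

theorem vertexDegree_sub (h : IsAlternatingTrail u v x e k) (y : V) :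
    (vertexDegree G (evenPart e (Finset.range k)) y : ℤ) -
      vertexDegree G (oddPart e (Finset.range k)) y = signedVertex x y 0 - signedVertex x y k := by
  rw [vertexDegree_evenPart_sub_oddPart, Finset.range_eq_Ico,
    sum_Ico_incidenceVec (Nat.zero_le k) h.edge_eq]

theorem le_degree (h : IsAlternatingTrail u v x e k) : k ≤ u.degree + v.degree := by
  have h1 := degree_evenPart_add_degree_oddPart e (Finset.range k)
  have h2 := Finsupp.degree_mono h.even_le
  have h3 := Finsupp.degree_mono h.odd_le
  rw [Finset.card_range] at h1
  omega

end IsAlternatingTrail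

theorem vertexDegree_mono (G : SimpleGraph V) : Monotone (vertexDegree G) := by
  intro u v h
  rw [← tsub_add_cancel_of_le h, map_add]
  exact le_add_of_nonneg_left zero_le

/-- If `u` and `v` have the same vertex degrees, then an alternating trail can be prolonged unless
it is closed. -/
theorem IsAlternatingTrail.exists_extend {G : SimpleGraph V} {u v : G.edgeSet →₀ ℕ} {x : ℕ → V}
    {e : ℕ → G.edgeSet} {k : ℕ} (h : IsAlternatingTrail u v x e k)
    (huv : vertexDegree G u = vertexDegree G v) (hk : Even k → x k ≠ x 0) :
    ∃ x' e', x' 0 = x 0 ∧ IsAlternatingTrail u v x' e' (k + 1) := by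
  have hsub := h.vertexDegree_sub (x k)
  have hle₁ := vertexDegree_mono G h.even_le (x k)
  have hle₂ := vertexDegree_mono G h.odd_le (x k)
  have huvk := DFunLike.congr_fun huv (x k)
  simp only [signedVertex, if_true] at hsub
  by_cases hev : Even k
  · rw [if_neg (hk hev).symm, hev.neg_one_pow] at hsub
    obtain ⟨f, hf, hlt⟩ := exists_lt_of_vertexDegree_lt (G := G)
      (u := evenPart e (Finset.range k)) (v := u) (x := x k) (by omega)
    exact h.extend hf (fun _ => hlt) fun h' => absurd hev h'
  · rw [(Nat.not_even_iff_odd.mp hev).neg_one_pow] at hsub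
    obtain ⟨f, hf, hlt⟩ := exists_lt_of_vertexDegree_lt (G := G)
      (u := oddPart e (Finset.range k)) (v := v) (x := x k) (by
        split_ifs at hsub <;> simp at hsub <;> omega)
    exact h.extend hf (fun h' => absurd h' hev) fun _ => hlt

namespace IsPrimitivePair_s10

variable {G : SimpleGraph V} {u v : G.edgeSet →₀ ℕ}

theorem eq_zero_of_le_of_le (h : IsPrimitivePair_s10 (vertexDegree G) u v) {w : G.edgeSet →₀ ℕ}
    (hu : w ≤ u) (hv : w ≤ v) : w = 0 := by
  have h1 := (h.eq_of_le (u - w) (v - w)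
    (fun h' => h.ne (by rw [← tsub_add_cancel_of_le hu, h', tsub_add_cancel_of_le hv])) (by
      apply add_right_cancel (b := vertexDegree G w)
      rw [← map_add, ← map_add, tsub_add_cancel_of_le hu, tsub_add_cancel_of_le hv, h.map_eq])
    tsub_le_self tsub_le_self).1
  have h2 := tsub_add_cancel_of_le hu
  rwa [h1, add_eq_left] at h2

/-- A primitive binomial of the toric ideal of a graph comes from an even closed walk. -/
theorem exists_closed_trail (h : IsPrimitivePair_s10 (vertexDegree G) u v) :
    ∃ (q : ℕ) (x : ℕ → V) (e : ℕ → G.edgeSet), 0 < q ∧ x (2 * q) = x 0 ∧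
      (∀ i < 2 * q, (e i : Sym2 V) = s(x i, x (i + 1))) ∧
      evenPart e (Finset.range (2 * q)) = u ∧ oddPart e (Finset.range (2 * q)) = v := by
  have hclosed : ∃ x e k, 0 < k ∧ Even k ∧ x k = x 0 ∧ IsAlternatingTrail u v x e k := by
    by_contra! hno
    have hu : u ≠ 0 := by
      intro hu
      have := degree_eq_of_vertexDegree_eq G h.map_eq
      rw [hu, map_zero, eq_comm, Finsupp.degree_eq_zero_iff] at this
      exact h.ne (hu.trans this.symm)
    obtain ⟨f, hf⟩ := Finsupp.ne_iff.mp hu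
    have hall : ∀ k, ∃ x e, IsAlternatingTrail u v x e (k + 1) := by
      intro k
      induction k with
      | zero =>
        obtain ⟨a, ha⟩ : ∃ a, a ∈ (f : Sym2 V) := ⟨_, Sym2.out_fst_mem _⟩
        have h0 : IsAlternatingTrail u v (fun _ => a) (fun _ => f) 0 :=
          ⟨by simp, by simp [evenPart], by simp [oddPart]⟩
        obtain ⟨x, e, -, h1⟩ := h0.extend ha
          (fun _ => by simpa [evenPart, Nat.pos_iff_ne_zero] using hf) (by simp)
        exact ⟨x, e, h1⟩
      | succ k ih =>
        obtain ⟨x, e, hx⟩ := ih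
        obtain ⟨x', e', -, h1⟩ := hx.exists_extend h.map_eq
          fun hev hxk => hno x e _ (Nat.succ_pos k) hev hxk hx
        exact ⟨x', e', h1⟩
    obtain ⟨x, e, hx⟩ := hall (u.degree + v.degree)
    have := hx.le_degree
    omega
  obtain ⟨x, e, k, hk0, ⟨q, hq⟩, hxk, hx⟩ := hclosed
  obtain rfl : k = 2 * q := by omega
  have hdeg := degree_evenPart_add_degree_oddPart e (Finset.range (2 * q))
  have hne : evenPart e (Finset.range (2 * q)) ≠ oddPart e (Finset.range (2 * q)) := by
    intro heq
    have h0 := h.eq_zero_of_le_of_le hx.even_le (heq ▸ hx.odd_le)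
    rw [← heq, h0] at hdeg
    simp at hdeg
    omega
  have hmap : vertexDegree G (evenPart e (Finset.range (2 * q))) =
      vertexDegree G (oddPart e (Finset.range (2 * q))) := by
    ext y
    have := hx.vertexDegree_sub y
    rw [show signedVertex x y 0 - signedVertex x y (2 * q) = 0 by
      rw [signedVertex, signedVertex, hxk]; simp] at this
    omega
  obtain ⟨h1, h2⟩ := h.eq_of_le _ _ hne hmap hx.even_le hx.odd_le
  exact ⟨q, x, e, by omega, hxk, hx.edge_eq, h1, h2⟩

/-- No proper nonempty set of positions of a primitive closed walk is balanced. -/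
theorem eq_empty_or_eq_range {q : ℕ} {e : ℕ → G.edgeSet}
    (h : IsPrimitivePair_s10 (vertexDegree G) (evenPart e (Finset.range (2 * q)))
      (oddPart e (Finset.range (2 * q)))) {S : Finset ℕ} (hS : S ⊆ Finset.range (2 * q))
    (hsum : ∀ y, ∑ i ∈ S, (-1) ^ i * (incidenceVec (e i : Sym2 V) y : ℤ) = 0) :
    S = ∅ ∨ S = Finset.range (2 * q) := by
  have h1 := evenPart_mono e hS
  have h2 := oddPart_mono e hS
  have hdeg := degree_evenPart_add_degree_oddPart e S
  by_cases heq : evenPart e S = oddPart e S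
  · left
    have h0 := h.eq_zero_of_le_of_le h1 (heq ▸ h2)
    rw [← heq, h0, map_zero, add_zero, eq_comm, Finset.card_eq_zero] at hdeg
    exact hdeg
  · right
    obtain ⟨h3, h4⟩ := h.eq_of_le _ _ heq (by
      ext y
      have := vertexDegree_evenPart_sub_oddPart e S y
      rw [hsum] at this
      omega) h1 h2
    rw [h3, h4, degree_evenPart_add_degree_oddPart] at hdeg
    exact Finset.eq_of_subset_of_card_le hS hdeg.le

end IsPrimitivePair_s10

/-! ### Noncrossing closed walks and the upper bound -/

/-- A closed walk of length `2 q` in which each vertex is visited at most once at positions of the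
same parity, and whose repeated visits do not cross. -/
structure IsNoncrossing (q : ℕ) (x : ℕ → V) : Prop where
  ne_succ : ∀ i < 2 * q, x i ≠ x (i + 1)
  closed : x (2 * q) = x 0
  mod_two_ne : ∀ i j, i < j → j < 2 * q → x i = x j → i % 2 ≠ j % 2
  not_crossing : ∀ i k j l, i < k → k < j → j < l → l < 2 * q → x i = x j → x k ≠ x l

namespace IsNoncrossing

variable {q : ℕ} {x : ℕ → V}

/-- The position `p` is the only visit of the walk to the vertex `x p`. -/
def IsSingle (q : ℕ) (x : ℕ → V) (p : ℕ) : Prop :=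
  p < 2 * q ∧ ∀ j < 2 * q, x j = x p → j = p

theorem not_triple (h : IsNoncrossing q x) {i j k : ℕ} (hij : i < j) (hjk : j < k) (hk : k < 2 * q)
    (h1 : x i = x j) (h2 : x j = x k) : False := by
  have := h.mod_two_ne i j hij (hjk.trans hk) h1
  have := h.mod_two_ne j k hjk hk h2
  have := h.mod_two_ne i k (hij.trans hjk) hk (h1.trans h2)
  omega

theorem exists_single_between (h : IsNoncrossing q x) {i j : ℕ} (hij : i < j) (hj : j < 2 * q)
    (hx : x i = x j) : ∃ p p', i < p ∧ p < p' ∧ p' < j ∧ IsSingle q x p ∧ IsSingle q x p' := by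
  induction hd : j - i using Nat.strong_induction_on generalizing i j with
  | _ d ih =>
    by_cases hin : ∃ k l, i < k ∧ k < l ∧ l < j ∧ x k = x l
    · obtain ⟨k, l, hik, hkl, hlj, hxkl⟩ := hin
      obtain ⟨p, p', h1, h2, h3, h4⟩ := ih (l - k) (by omega) hkl (by omega) hxkl rfl
      exact ⟨p, p', by omega, h2, by omega, h4⟩
    · push Not at hin
      have hsingle : ∀ p, i < p → p < j → IsSingle q x p := by
        intro p hip hpj
        refine ⟨by omega, fun m hm hmp => ?_⟩
        by_contra hne
        rcases lt_trichotomy m i with hmi | rfl | hmi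
        · exact h.not_crossing m i p j hmi hip hpj hj hmp hx
        · exact h.not_triple hip hpj hj hmp (hmp.symm.trans hx)
        rcases lt_trichotomy m j with hmj | rfl | hmj
        · rcases lt_or_gt_of_ne hne with hlt | hlt
          · exact hin m p hmi hlt hpj hmp
          · exact hin p m hip hlt hmj hmp.symm
        · exact h.not_triple hip hpj hm (hx.trans hmp) hmp.symm
        · exact h.not_crossing i p j m hip hpj hmj hm hx hmp.symm
      have h1 := h.mod_two_ne i j hij hj hx
      have h2 : j ≠ i + 1 := by
        rintro rfl
        exact h.ne_succ i (by omega) hx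
      exact ⟨i + 1, i + 2, by omega, by omega, by omega, hsingle _ (by omega) (by omega),
        hsingle _ (by omega) (by omega)⟩

theorem exists_three_single (h : IsNoncrossing q x) (hq : 2 ≤ q) : ∃ p₁ p₂ p₃, p₁ < p₂ ∧ p₂ < p₃ ∧
    IsSingle q x p₁ ∧ IsSingle q x p₂ ∧ IsSingle q x p₃ := by
  by_cases h0 : IsSingle q x 0
  · by_cases hchord : ∃ i j, i < j ∧ j < 2 * q ∧ x i = x j
    · obtain ⟨i, j, hij, hj, hx⟩ := hchord
      obtain ⟨p, p', h1, h2, h3, h4, h5⟩ := h.exists_single_between hij hj hx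
      exact ⟨0, p, p', by omega, h2, h0, h4, h5⟩
    · push Not at hchord
      have hsingle : ∀ p < 2 * q, IsSingle q x p := by
        refine fun p hp => ⟨hp, fun m hm hmp => ?_⟩
        rcases lt_trichotomy m p with hlt | heq | hlt
        · exact absurd hmp (hchord m p hlt hp)
        · exact heq
        · exact absurd hmp.symm (hchord p m hlt hm)
      exact ⟨0, 1, 2, by omega, by omega, h0, hsingle 1 (by omega), hsingle 2 (by omega)⟩
  · obtain ⟨j, hj, hxj, hj0⟩ : ∃ j < 2 * q, x j = x 0 ∧ j ≠ 0 := by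
      by_contra! hno
      exact h0 ⟨by omega, hno⟩
    have hj0 : 0 < j := Nat.pos_of_ne_zero hj0
    obtain ⟨p, p', h1, h2, h3, h4, h5⟩ := h.exists_single_between hj0 hj hxj.symm
    have hjlast : j < 2 * q - 1 := by
      refine lt_of_le_of_ne (by omega) ?_
      rintro rfl
      refine h.ne_succ (2 * q - 1) (by omega) ?_
      rw [show 2 * q - 1 + 1 = 2 * q by omega, h.closed, hxj]
    by_cases hlast : IsSingle q x (2 * q - 1)
    · exact ⟨p, p', 2 * q - 1, h2, by omega, h4, h5, hlast⟩
    · obtain ⟨m, hm, hxm, hmne⟩ : ∃ m < 2 * q, x m = x (2 * q - 1) ∧ m ≠ 2 * q - 1 := by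
        by_contra! hno
        exact hlast ⟨by omega, hno⟩
      have hjm : j < m := by
        by_contra! hle
        rcases Nat.eq_zero_or_pos m with rfl | hm0
        · exact h.not_triple hj0 hjlast (by omega) hxj.symm (hxj.trans hxm)
        rcases hle.lt_or_eq with hlt | rfl
        · exact h.not_crossing 0 m j _ hm0 hlt hjlast (by omega) hxj.symm hxm
        · exact h.not_triple hj0 hjlast (by omega) hxj.symm hxm
      obtain ⟨r, r', k1, k2, k3, k4, -⟩ :=
        h.exists_single_between (i := m) (j := 2 * q - 1) (by omega) (by omega) hxm
      exact ⟨p, p', r, h2, by omega, h4, h5, k4⟩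

theorem add_two_le_card [Fintype V] (h : IsNoncrossing q x) (hq : 2 ≤ q) :
    q + 2 ≤ Fintype.card V := by
  classical
  obtain ⟨p₁, p₂, p₃, h12, h23, s1, s2, s3⟩ := h.exists_three_single hq
  let c : V → ℕ := fun y => ((Finset.range (2 * q)).filter fun i => x i = y).card
  let T : Finset V := {x p₁, x p₂, x p₃}
  have hT : T.card = 3 := by
    have hne : ∀ {p p'}, p < p' → IsSingle q x p → IsSingle q x p' → x p ≠ x p' :=
      fun hlt hs hs' heq => hlt.ne (hs'.2 _ hs.1 heq)
    exact Finset.card_eq_three.mpr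
      ⟨_, _, _, hne h12 s1 s2, hne (h12.trans h23) s1 s3, hne h23 s2 s3, rfl⟩
  have hc : ∑ y, c y = 2 * q := by
    rw [← Finset.card_range (2 * q)]
    exact (Finset.card_eq_sum_card_fiberwise fun i _ => Finset.mem_univ (x i)).symm
  have hc2 : ∀ y, c y ≤ 2 := by
    intro y
    rw [← Finset.card_range 2]
    refine Finset.card_le_card_of_injOn (· % 2)
      (fun i _ => by simpa using Nat.mod_lt i two_pos) fun i hi j hj hij => ?_
    simp only [Finset.coe_filter, Finset.mem_range, Set.mem_ofPred_eq] at hi hj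
    rcases lt_trichotomy i j with hlt | heq | hlt
    · exact absurd hij (h.mod_two_ne i j hlt hj.1 (hi.2.trans hj.2.symm))
    · exact heq
    · exact absurd hij.symm (h.mod_two_ne j i hlt hi.1 (hj.2.trans hi.2.symm))
  have hc1 : ∀ p, IsSingle q x p → c (x p) ≤ 1 := by
    intro p hp
    refine Finset.card_le_one.mpr fun i hi j hj => ?_
    simp only [Finset.mem_filter, Finset.mem_range] at hi hj
    rw [hp.2 i hi.1 hi.2, hp.2 j hj.1 hj.2]
  have hsum : ∑ y, (c y + if y ∈ T then 1 else 0) ≤ ∑ _y : V, 2 := by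
    refine Finset.sum_le_sum fun y _ => ?_
    split_ifs with hy
    · simp only [T, Finset.mem_insert, Finset.mem_singleton] at hy
      rcases hy with rfl | rfl | rfl
      · have := hc1 _ s1; omega
      · have := hc1 _ s2; omega
      · have := hc1 _ s3; omega
    · exact hc2 y
  rw [Finset.sum_add_distrib, hc, Finset.sum_ite_mem, Finset.univ_inter] at hsum
  simp only [Finset.sum_const, hT, Finset.card_univ, smul_eq_mul] at hsum
  omega

end IsNoncrossing

/-- A primitive binomial of the toric ideal of a graph on `n` vertices has degree at most
`n - 2`. -/
theorem IsPrimitivePair_s10.degree_add_two_le [Fintype V] {G : SimpleGraph V} {u v : G.edgeSet →₀ ℕ}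
    (h : IsPrimitivePair_s10 (vertexDegree G) u v) : u.degree + 2 ≤ Fintype.card V := by
  obtain ⟨q, x, e, hq, hclosed, hedge, rfl, rfl⟩ := h.exists_closed_trail
  have hdeg := degree_evenPart_add_degree_oddPart e (Finset.range (2 * q))
  rw [← degree_eq_of_vertexDegree_eq G h.map_eq, Finset.card_range] at hdeg
  have hsum : ∀ i j, i ≤ j → j ≤ 2 * q → ∀ y,
      ∑ k ∈ Finset.Ico i j, (-1) ^ k * (incidenceVec (e k : Sym2 V) y : ℤ) =
        signedVertex x y i - signedVertex x y j := fun i j hij hj y =>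
    sum_Ico_incidenceVec hij (fun k hk => hedge k (by omega)) y
  have hmod : ∀ i j, i < j → j < 2 * q → x i = x j → i % 2 ≠ j % 2 := by
    intro i j hij hj hx hmod
    have hpow : (-1 : ℤ) ^ i = (-1) ^ j := by
      rw [← Nat.mod_add_div i 2, ← Nat.mod_add_div j 2, hmod]
      simp [pow_add, pow_mul]
    rcases h.eq_empty_or_eq_range (S := Finset.Ico i j)
      (fun k hk => by simp at hk ⊢; omega) (fun y => by
        rw [hsum i j hij.le hj.le, signedVertex, signedVertex, hx, hpow, sub_self]) with h' | h'
    · have := congrArg Finset.card h'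
      simp at this
      omega
    · have := congrArg Finset.card h'
      simp at this
      omega
  have hneg : ∀ i j, i < j → j < 2 * q → x i = x j → ∀ y,
      signedVertex x y i = - signedVertex x y j := by
    intro i j hij hj hx y
    have hne := hmod i j hij hj hx
    have hpow : (-1 : ℤ) ^ i = - (-1) ^ j := by
      rcases Nat.even_or_odd i with hi | hi
      · have hj' : Odd j := Nat.odd_iff.mpr (by have := Nat.even_iff.mp hi; omega)
        rw [hi.neg_one_pow, hj'.neg_one_pow, neg_neg]
      · have hj' : Even j := Nat.even_iff.mpr (by have := Nat.odd_iff.mp hi; omega)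
        rw [hi.neg_one_pow, hj'.neg_one_pow]
    rw [signedVertex, signedVertex, hx, hpow]
    split_ifs <;> simp
  have hnc : IsNoncrossing q x := by
    refine ⟨fun i hi hx => ?_, hclosed, hmod, fun i k j l hik hkj hjl hl hij hkl => ?_⟩
    · have := G.not_isDiag_of_mem_edgeSet (e i).2
      rw [hedge i hi, Sym2.mk_isDiag_iff] at this
      exact this hx
    · have hdisj : Disjoint (Finset.Ico i k) (Finset.Ico j l) :=
        Finset.disjoint_left.mpr fun m hm hm' => by
          simp only [Finset.mem_Ico] at hm hm'; omega
      rcases h.eq_empty_or_eq_range (S := Finset.Ico i k ∪ Finset.Ico j l)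
        (fun m hm => by simp only [Finset.mem_union, Finset.mem_Ico, Finset.mem_range] at hm ⊢; omega)
        (fun y => by
          rw [Finset.sum_union hdisj, hsum i k hik.le (by omega), hsum j l hjl.le hl.le,
            hneg i j (by omega) (by omega) hij, hneg k l (by omega) hl hkl]
          ring) with h' | h'
      all_goals
        have := congrArg Finset.card h'
        rw [Finset.card_union_of_disjoint hdisj] at this
        simp at this
        omega
  have hq2 : 2 ≤ q := by
    by_contra hlt
    obtain rfl : q = 1 := by omega
    refine h.ne ?_
    have h01 : e 0 = e 1 := by
      apply Subtype.ext
      rw [hedge 0 (by omega), hedge 1 (by omega), Sym2.eq_swap]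
      simpa using Or.inl hclosed.symm
    simp [evenPart, oddPart, Finset.sum_filter, Finset.sum_range_succ, h01]
  have := hnc.add_two_le_card hq2
  omega

/-! ### Two triangles joined by a path -/

theorem exists_ne_vertexDegree_eq [Fintype V] [Nonempty V] {ι : Type*} [Fintype ι]
    {G : SimpleGraph V} (ε : ι ↪ G.edgeSet) (h : Fintype.card V < Fintype.card ι) :
    ∃ u v : G.edgeSet →₀ ℕ, u ≠ v ∧ vertexDegree G u = vertexDegree G v ∧
      (∀ e ∉ Set.range ε, u e = 0) ∧ ∀ e ∉ Set.range ε, v e = 0 := by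
  obtain ⟨t, ht, htA, -⟩ := Int.Matrix.exists_ne_zero_int_vec_norm_le
    (Matrix.of fun (x : V) (j : ι) => (incidenceVec (ε j : Sym2 V) x : ℤ)) h Fintype.card_pos
  let w (s : ι → ℤ) : G.edgeSet →₀ ℕ :=
    Finsupp.embDomain ε (Finsupp.equivFunOnFinite.symm fun j => (s j).toNat)
  have hw (s : ι → ℤ) (j : ι) : w s (ε j) = (s j).toNat := Finsupp.embDomain_apply_self _ _ _
  have hdeg (s : ι → ℤ) (x : V) :
      vertexDegree G (w s) x = ∑ j, (s j).toNat * incidenceVec (ε j : Sym2 V) x := by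
    rw [vertexDegree_apply, Finsupp.sum_embDomain, Finsupp.sum_fintype _ _ (by simp)]
    simp
  refine ⟨w t, w (-t), fun hne => ht ?_, ?_, fun e => Finsupp.embDomain_of_notMem_range _ _ _,
    fun e => Finsupp.embDomain_of_notMem_range _ _ _⟩
  · funext j
    have := DFunLike.congr_fun hne (ε j)
    rw [hw, hw, Pi.neg_apply] at this
    rw [Pi.zero_apply]
    omega
  · ext x
    have hx := congrFun htA x
    rw [hdeg, hdeg]
    zify
    rw [← sub_eq_zero, ← Finset.sum_sub_distrib, ← Pi.zero_apply (M := fun _ : V => ℤ) x, ← hx]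
    refine Finset.sum_congr rfl fun j _ => ?_
    rw [← sub_mul, mul_comm, Pi.neg_apply, ← Int.toNat_sub_toNat_neg (t j)]
    simp

theorem vertexDegree_apply_of_eq_zero {ι : Type*} [Fintype ι] {G : SimpleGraph V}
    (ε : ι ↪ G.edgeSet) {w : G.edgeSet →₀ ℕ} (hw : ∀ e ∉ Set.range ε, w e = 0) (x : V) :
    vertexDegree G w x = ∑ j, w (ε j) * incidenceVec (ε j : Sym2 V) x := by
  classical
  rw [vertexDegree_apply, Finsupp.sum_of_support_subset (s := Finset.univ.map ε) _ _ _ (by simp),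
    Finset.sum_map]
  intro e he
  by_contra hne
  exact Finsupp.mem_support_iff.mp he (hw e fun ⟨j, hj⟩ => hne (by simp [← hj]))

/-- The endpoints of the `j`-th edge of the graph on `0, …, m + 3` which is the path
`0, 1, …, m + 3` together with the edges `{0, 2}` and `{m + 1, m + 3}`. -/
def twoTrianglesEnds (m j : ℕ) : ℕ × ℕ :=
  if j < m + 3 then (j, j + 1) else if j = m + 3 then (0, 2) else (m + 1, m + 3)

/-- The degree of the vertex `i` when the `j`-th edge described by `twoTrianglesEnds` has
multiplicity `a j`. -/
def twoTrianglesDegree (m : ℕ) (a : ℕ → ℕ) (i : ℕ) : ℕ :=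
  (if i < m + 3 then a i else 0) + (if 1 ≤ i then a (i - 1) else 0) +
    (if i = 0 ∨ i = 2 then a (m + 3) else 0) + (if i = m + 1 ∨ i = m + 3 then a (m + 4) else 0)

theorem exists_twoTriangles (m : ℕ) :
    ∃ ε : Fin (m + 5) ↪ (⊤ : SimpleGraph (Fin (m + 4))).edgeSet, ∀ j i,
      incidenceVec (ε j : Sym2 (Fin (m + 4))) i =
        (if (i : ℕ) = (twoTrianglesEnds m j).1 then 1 else 0) +
          if (i : ℕ) = (twoTrianglesEnds m j).2 then 1 else 0 := by
  have h1 (j : Fin (m + 5)) : (twoTrianglesEnds m j).1 < (twoTrianglesEnds m j).2 := by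
    unfold twoTrianglesEnds
    split_ifs <;> simp
  have h2 (j : Fin (m + 5)) : (twoTrianglesEnds m j).2 < m + 4 := by
    unfold twoTrianglesEnds
    split_ifs <;> grind
  refine ⟨⟨fun j => ⟨s(⟨_, (h1 j).trans (h2 j)⟩, ⟨_, h2 j⟩), ?_⟩, fun j k hjk => ?_⟩, fun j i => ?_⟩
  · simpa using (h1 j).ne
  · have hjk := Subtype.ext_iff.mp hjk
    simp only [Sym2.eq_iff, Fin.mk.injEq] at hjk
    have hj := h1 j
    have hk := h1 k
    have h : twoTrianglesEnds m j = twoTrianglesEnds m k := Prod.ext (by omega) (by omega)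
    ext
    grind [twoTrianglesEnds]
  · change incidenceVec s(_, _) i = _
    simp only [incidenceVec_mk, Finsupp.add_apply, Finsupp.single_apply, Fin.ext_iff,
      eq_comm (a := (i : ℕ))]

theorem sum_twoTrianglesEnds (m : ℕ) (a : ℕ → ℕ) {i : ℕ} (hi : i < m + 4) :
    ∑ j ∈ Finset.range (m + 5), a j * ((if i = (twoTrianglesEnds m j).1 then 1 else 0) +
        if i = (twoTrianglesEnds m j).2 then 1 else 0) = twoTrianglesDegree m a i := by
  have hpath : ∑ j ∈ Finset.range (m + 3), a j * ((if i = (twoTrianglesEnds m j).1 then 1 else 0) +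
        if i = (twoTrianglesEnds m j).2 then 1 else 0) =
      (if i < m + 3 then a i else 0) + if 1 ≤ i then a (i - 1) else 0 := by
    have : ∀ j ∈ Finset.range (m + 3), a j * ((if i = (twoTrianglesEnds m j).1 then 1 else 0) +
        if i = (twoTrianglesEnds m j).2 then 1 else 0) =
        (if i = j then a j else 0) + if i = j + 1 then a j else 0 := fun j hj => by
      rw [twoTrianglesEnds, if_pos (Finset.mem_range.mp hj), mul_add, mul_ite, mul_ite]
      simp
    rw [Finset.sum_congr rfl this, Finset.sum_add_distrib, Finset.sum_ite_eq]
    congr 1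
    · simp
    · rcases i with - | i
      · simp
      · simp only [Nat.add_right_cancel_iff, Finset.sum_ite_eq, Finset.mem_range]
        simp
        omega
  rw [Finset.sum_range_succ, Finset.sum_range_succ, hpath, twoTrianglesDegree]
  simp only [twoTrianglesEnds, lt_irrefl, if_false, if_true]
  split_ifs <;> omega

theorem le_twoTrianglesDegree {m : ℕ} {a b : ℕ → ℕ}
    (hab : ∀ i < m + 4, twoTrianglesDegree m a i = twoTrianglesDegree m b i)
    (hne : ∃ j < m + 5, a j ≠ b j) {i : ℕ} (hi : i < m + 4) :
    (if 2 ≤ i ∧ i < m + 2 then 2 else 1) ≤ twoTrianglesDegree m a i := by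
  obtain ⟨j, hj, hne⟩ := hne
  rcases m with - | m
  · have h0 := hab 0 (by omega)
    have h1 := hab 1 (by omega)
    have h2 := hab 2 (by omega)
    have h3 := hab 3 (by omega)
    simp only [twoTrianglesDegree] at h0 h1 h2 h3 ⊢
    interval_cases i <;> interval_cases j <;> simp at h0 h1 h2 h3 ⊢ <;> omega
  have h0 : a 0 + a (m + 4) = b 0 + b (m + 4) := by
    simpa [twoTrianglesDegree] using hab 0 (by omega)
  have h1 : a 1 + a 0 = b 1 + b 0 := by
    simpa [twoTrianglesDegree] using hab 1 (by omega)
  have hpath : ∀ k, 2 ≤ k → k ≤ m → a (k + 1) + a k = b (k + 1) + b k := fun k hk hkm => by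
    have := hab (k + 1) (by omega)
    simpa [twoTrianglesDegree, show k < m + 3 by omega, show ¬ k + 1 = 2 by omega,
      show k ≠ m + 1 by omega, show k ≠ m + 3 by omega] using this
  have hmid : ∀ k, 2 ≤ k → k ≤ m + 1 → (a k : ℤ) - b k = 2 * (a (m + 4) - b (m + 4)) ∨
      (a k : ℤ) - b k = -(2 * (a (m + 4) - b (m + 4))) := by
    intro k hk
    induction k, hk using Nat.le_induction with
    | base =>
      intro hkm
      have h2 := hab 2 (by omega)
      simp [twoTrianglesDegree, add_assoc, show m ≠ 0 by omega] at h2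
      omega
    | succ k hk ih =>
      intro hkm
      have := hpath k hk (by omega)
      have := ih (by omega)
      omega
  have hlast : a (m + 3) + a (m + 5) = b (m + 3) + b (m + 5) := by
    simpa [twoTrianglesDegree] using hab (m + 4) (by omega)
  have hlast' : a (m + 3) + a (m + 2) = b (m + 3) + b (m + 2) := by
    simpa [twoTrianglesDegree] using hab (m + 3) (by omega)
  have hend : (a (m + 5) : ℤ) - b (m + 5) = a (m + 4) - b (m + 4) ∨
      (a (m + 5) : ℤ) - b (m + 5) = -(a (m + 4) - b (m + 4)) := by
    have h2 := hab (m + 2) (by omega)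
    rcases m with - | m
    · simp [twoTrianglesDegree] at *
      omega
    · have := hmid (m + 2) (by omega) (by omega)
      simp only [add_assoc, Nat.reduceAdd] at *
      simp [twoTrianglesDegree, add_assoc] at h2
      omega
  have hpos : (a (m + 4) : ℤ) - b (m + 4) ≠ 0 := by
    intro h
    have hj' : j = 0 ∨ j = 1 ∨ (2 ≤ j ∧ j ≤ m + 1) ∨ j = m + 2 ∨ j = m + 3 ∨ j = m + 4 ∨
        j = m + 5 := by omega
    rcases hj' with rfl | rfl | ⟨hj2, hjm⟩ | rfl | rfl | rfl | rfl
    any_goals omega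
    have := hmid j hj2 hjm
    omega
  have hi' : i = 0 ∨ i = 1 ∨ (2 ≤ i ∧ i ≤ m + 1) ∨ i = m + 2 ∨ i = m + 3 ∨ i = m + 4 := by omega
  have hdeg := hab i hi
  rcases hi' with rfl | rfl | ⟨hi2, him⟩ | rfl | rfl | rfl
  · simp [twoTrianglesDegree, add_assoc]
    omega
  · simp [twoTrianglesDegree, add_assoc]
    omega
  · have := hmid i hi2 him
    have hle (c : ℕ → ℕ) : c i ≤ twoTrianglesDegree (m + 1) c i := by
      rw [twoTrianglesDegree, if_pos (by omega)]
      omega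
    have := hle a
    have := hle b
    split_ifs <;> omega
  · rcases m with - | m
    · simp [twoTrianglesDegree] at *
      omega
    · have := hmid (m + 2) (by omega) (by omega)
      simp only [add_assoc, Nat.reduceAdd] at *
      simp [twoTrianglesDegree, add_assoc] at hdeg ⊢
      omega
  · simp [twoTrianglesDegree, add_assoc]
    omega
  · simp [twoTrianglesDegree, add_assoc]
    omega

theorem le_degree_of_eq_zero_of_notMem_range {m : ℕ}
    {ε : Fin (m + 5) ↪ (⊤ : SimpleGraph (Fin (m + 4))).edgeSet}
    (hε : ∀ j i, incidenceVec (ε j : Sym2 (Fin (m + 4))) i =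
      (if (i : ℕ) = (twoTrianglesEnds m j).1 then 1 else 0) +
        if (i : ℕ) = (twoTrianglesEnds m j).2 then 1 else 0)
    {w z : (⊤ : SimpleGraph (Fin (m + 4))).edgeSet →₀ ℕ} (hne : w ≠ z)
    (hwz : vertexDegree ⊤ w = vertexDegree ⊤ z) (hw : ∀ e ∉ Set.range ε, w e = 0)
    (hz : ∀ e ∉ Set.range ε, z e = 0) : m + 2 ≤ w.degree := by
  let mult (u : (⊤ : SimpleGraph (Fin (m + 4))).edgeSet →₀ ℕ) (j : ℕ) : ℕ :=
    if h : j < m + 5 then u (ε ⟨j, h⟩) else 0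
  have hmult (u) (j : Fin (m + 5)) : mult u j = u (ε j) := dif_pos j.2
  have hdeg {u} (hu : ∀ e ∉ Set.range ε, u e = 0) (i : Fin (m + 4)) :
      vertexDegree ⊤ u i = twoTrianglesDegree m (mult u) i := by
    rw [vertexDegree_apply_of_eq_zero ε hu, ← sum_twoTrianglesEnds m _ i.2,
      Finset.sum_range]
    exact Finset.sum_congr rfl fun j _ => by rw [hmult, hε]
  have hbound (i : Fin (m + 4)) :
      (if 2 ≤ (i : ℕ) ∧ (i : ℕ) < m + 2 then 2 else 1) ≤ vertexDegree ⊤ w i := by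
    rw [hdeg hw]
    refine le_twoTrianglesDegree (b := mult z) (fun i hi => ?_) ?_ i.2
    · rw [← hdeg hw ⟨i, hi⟩, ← hdeg hz ⟨i, hi⟩, hwz]
    · by_contra! heq
      refine hne (Finsupp.ext fun e => ?_)
      by_cases he : e ∈ Set.range ε
      · obtain ⟨j, rfl⟩ := he
        rw [← hmult, ← hmult, heq j j.2]
      · rw [hw e he, hz e he]
  have hsum := Finset.sum_le_sum fun i (_ : i ∈ Finset.univ) => hbound i
  rw [← Finsupp.degree_eq_sum, degree_vertexDegree,
    Fin.sum_univ_eq_sum_range fun i => if 2 ≤ i ∧ i < m + 2 then 2 else 1,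
    Finset.sum_range_succ, Finset.sum_range_succ, add_comm m 2, Finset.sum_range_add,
    Finset.sum_congr (s₂ := Finset.range m) rfl fun i hi => if_pos (by
      have := Finset.mem_range.mp hi
      omega)] at hsum
  simp [Finset.sum_range_succ] at hsum
  omega

/-- For `n ≥ 4`, the largest total degree of a binomial in the universal
Gröbner basis of `I_{K_n}` is exactly `n - 2`. -/
theorem maxDegree_universalGB_completeGraph (K : Type*) [Field K] (n : ℕ) (hn : 4 ≤ n) :
    IsGreatest {d : ℕ | ∃ f ∈ UniversalGB (graphToricIdeal K (⊤ : SimpleGraph (Fin n))),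
      f.totalDegree = d} (n - 2) := by
  have hA : ∀ u v, vertexDegree (⊤ : SimpleGraph (Fin n)) u = vertexDegree ⊤ v →
      u.degree = v.degree := fun _ _ => degree_eq_of_vertexDegree_eq ⊤
  constructor
  · obtain ⟨m, rfl⟩ : ∃ m, n = m + 4 := ⟨n - 4, by omega⟩
    obtain ⟨ε, hε⟩ := exists_twoTriangles m
    obtain ⟨u, v, huv, hAuv, hu, hv⟩ := exists_ne_vertexDegree_eq ε (by simp)
    obtain ⟨w, z, hmem, hprim, hw, hz⟩ := (isToric_graphToricIdeal (K := K) ⊤).exists_mem_universalGB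
      hA huv hAuv hu hv
    refine ⟨_, hmem, ?_⟩
    rw [totalDegree_binom hprim.ne (hA _ _ hprim.map_eq)]
    have hlower := le_degree_of_eq_zero_of_notMem_range hε hprim.ne hprim.map_eq hw hz
    have hupper := hprim.degree_add_two_le
    rw [Fintype.card_fin] at hupper
    omega
  · rintro _ ⟨f, ⟨t, 𝒢, h, hf⟩, rfl⟩
    obtain ⟨v, hfv, hprim⟩ := h.exists_isPrimitivePair (isToric_graphToricIdeal ⊤) hA hf
    have hupper := hprim.degree_add_two_le
    rw [Fintype.card_fin] at hupper
    rw [hfv, totalDegree_binom hprim.ne (hA _ _ hprim.map_eq)]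
    omega

end
end
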